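/- arXiv:1410.6072 — 7 statements merged into one kernel-verified Lean document; each statement's English description precedes it below -/
import Mathlib

section
/- Let F be ℝ or ℂ, let A ∈ F^{n₁×⋯×n_d} be a d-tensor, and let x₁ ∈ F^{m₁}, …, x_e ∈ F^{m_e}. Then the spectral norm satisfies ‖A ⊗ x₁ ⊗ ⋯ ⊗ x_e‖_{σ,F} = ‖A‖_{σ,F} · ‖x₁‖ ⋯ ‖x_e‖, and the nuclear norm satisfies ‖A ⊗ x₁ ⊗ ⋯ ⊗ x_e‖_{*,F} = ‖A‖_{*,F} · ‖x₁‖ ⋯ ‖x_e‖. -/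
open scoped BigOperators

noncomputable section

variable {𝕜 : Type} [RCLike 𝕜]

/-- The outer (tensor) product of vectors `x k ∈ 𝕜^{n k}`, giving the rank-one tensor
with entries `∏ k, (x k) (i k)`. -/
def rankOne {ι : Type} [Fintype ι] {n : ι → ℕ}
    (x : (k : ι) → EuclideanSpace 𝕜 (Fin (n k))) : ((k : ι) → Fin (n k)) → 𝕜 :=
  fun i => ∏ k, x k (i k)

/-- The Hermitian inner product of two tensors (conjugation on the second argument). -/
def tInner {ι : Type} [Fintype ι] [DecidableEq ι] {n : ι → ℕ}
    (A B : ((k : ι) → Fin (n k)) → 𝕜) : 𝕜 :=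
  ∑ i, A i * (starRingEnd 𝕜) (B i)

/-- The spectral norm of a tensor. -/
def specNorm {ι : Type} [Fintype ι] [DecidableEq ι] {n : ι → ℕ}
    (A : ((k : ι) → Fin (n k)) → 𝕜) : ℝ :=
  sSup { r : ℝ | ∃ x : (k : ι) → EuclideanSpace 𝕜 (Fin (n k)),
    (∀ k, ‖x k‖ = 1) ∧ r = ‖tInner A (rankOne x)‖ }

/-- The nuclear norm of a tensor. -/
def nucNorm {ι : Type} [Fintype ι] [DecidableEq ι] {n : ι → ℕ}
    (A : ((k : ι) → Fin (n k)) → 𝕜) : ℝ :=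
  sInf { s : ℝ | ∃ (r : ℕ) (x : Fin r → (k : ι) → EuclideanSpace 𝕜 (Fin (n k))),
    A = (∑ i, rankOne (x i)) ∧ s = ∑ i, ∏ k, ‖x i k‖ }

section TensorProducts

variable {ι κ : Type} [Fintype ι] [DecidableEq ι] [Fintype κ] [DecidableEq κ]
  {n : ι → ℕ} {m : κ → ℕ}

/-- The outer product `A ⊗ x₁ ⊗ ⋯ ⊗ x_e` of a tensor with a family of vectors. -/
def outerVec (A : ((k : ι) → Fin (n k)) → 𝕜) (x : (k : κ) → EuclideanSpace 𝕜 (Fin (m k))) :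
    ((k : ι ⊕ κ) → Fin (Sum.elim n m k)) → 𝕜 :=
  fun i => A (fun k => i (Sum.inl k)) * ∏ k, x k (i (Sum.inr k))

/-- A multi-index over a sum type is a pair of multi-indices. -/
def splitIndex (n : ι → ℕ) (m : κ → ℕ) :
    ((k : ι ⊕ κ) → Fin (Sum.elim n m k)) ≃ ((k : ι) → Fin (n k)) × ((k : κ) → Fin (m k)) :=
  Equiv.sumPiEquivProdPi fun k => Fin (Sum.elim n m k)

omit [Fintype ι] [DecidableEq ι] [DecidableEq κ] in
theorem outerVec_splitIndex_symm (A : ((k : ι) → Fin (n k)) → 𝕜)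
    (x : (k : κ) → EuclideanSpace 𝕜 (Fin (m k)))
    (p : ((k : ι) → Fin (n k)) × ((k : κ) → Fin (m k))) :
    outerVec A x ((splitIndex n m).symm p) = A p.1 * rankOne x p.2 :=
  rfl

/-- The concatenation of two families of vectors. -/
def joinVec (u : (k : ι) → EuclideanSpace 𝕜 (Fin (n k)))
    (z : (k : κ) → EuclideanSpace 𝕜 (Fin (m k))) :
    (k : ι ⊕ κ) → EuclideanSpace 𝕜 (Fin (Sum.elim n m k))
  | Sum.inl k => u k
  | Sum.inr k => z k

omit [DecidableEq ι] [DecidableEq κ] in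
theorem rankOne_joinVec (u : (k : ι) → EuclideanSpace 𝕜 (Fin (n k)))
    (z : (k : κ) → EuclideanSpace 𝕜 (Fin (m k))) :
    rankOne (joinVec u z) = outerVec (rankOne u) z := by
  funext i
  simp only [rankOne, outerVec, Fintype.prod_sum_type]
  rfl

omit [DecidableEq ι] [DecidableEq κ] in
theorem prod_norm_joinVec (u : (k : ι) → EuclideanSpace 𝕜 (Fin (n k)))
    (z : (k : κ) → EuclideanSpace 𝕜 (Fin (m k))) :
    ∏ k, ‖joinVec u z k‖ = (∏ k, ‖u k‖) * ∏ k, ‖z k‖ := by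
  rw [Fintype.prod_sum_type]
  rfl

omit [RCLike 𝕜] [Fintype ι] [DecidableEq ι] [Fintype κ] [DecidableEq κ] in
/-- Every family indexed by a sum type is a concatenation. -/
theorem exists_eq_joinVec (y : (k : ι ⊕ κ) → EuclideanSpace 𝕜 (Fin (Sum.elim n m k))) :
    ∃ (u : (k : ι) → EuclideanSpace 𝕜 (Fin (n k)))
      (z : (k : κ) → EuclideanSpace 𝕜 (Fin (m k))), y = joinVec u z :=
  ⟨fun k => y (Sum.inl k), fun k => y (Sum.inr k), by funext k; cases k <;> rfl⟩

theorem sum_rankOne_mul_conj (z w : (k : κ) → EuclideanSpace 𝕜 (Fin (m k))) :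
    ∑ l, rankOne z l * (starRingEnd 𝕜) (rankOne w l) = ∏ k, inner 𝕜 (w k) (z k) := by
  simp only [PiLp.inner_apply, RCLike.inner_apply, rankOne, map_prod, ← Finset.prod_mul_distrib]
  rw [Finset.prod_univ_sum, Fintype.piFinset_univ]

theorem tInner_outerVec (A B : ((k : ι) → Fin (n k)) → 𝕜)
    (x z : (k : κ) → EuclideanSpace 𝕜 (Fin (m k))) :
    tInner (outerVec A x) (outerVec B z) = tInner A B * ∏ k, inner 𝕜 (z k) (x k) := by
  rw [← sum_rankOne_mul_conj]
  unfold tInner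
  rw [Finset.sum_mul_sum, ← Fintype.sum_prod_type', ← (splitIndex n m).symm.sum_comp]
  refine Finset.sum_congr rfl fun p _ => ?_
  simp only [outerVec_splitIndex_symm, map_mul]
  exact mul_mul_mul_comm _ _ _ _

omit [DecidableEq ι] in
theorem norm_rankOne_le_one {y : (k : ι) → EuclideanSpace 𝕜 (Fin (n k))}
    (hy : ∀ k, ‖y k‖ = 1) (i : (k : ι) → Fin (n k)) : ‖rankOne y i‖ ≤ 1 := by
  rw [rankOne, norm_prod]
  exact Finset.prod_le_one (fun _ _ => norm_nonneg _) fun k _ =>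
    (PiLp.norm_apply_le (y k) (i k)).trans (hy k).le

theorem specNorm_bddAbove (A : ((k : ι) → Fin (n k)) → 𝕜) :
    BddAbove { r : ℝ | ∃ x : (k : ι) → EuclideanSpace 𝕜 (Fin (n k)),
      (∀ k, ‖x k‖ = 1) ∧ r = ‖tInner A (rankOne x)‖ } := by
  refine ⟨∑ i, ‖A i‖, ?_⟩
  rintro _ ⟨y, hy, rfl⟩
  refine norm_sum_le_of_le _ fun i _ => ?_
  rw [norm_mul, RCLike.norm_conj]
  exact mul_le_of_le_one_right (norm_nonneg _) (norm_rankOne_le_one hy i)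

theorem norm_tInner_rankOne_le_specNorm (A : ((k : ι) → Fin (n k)) → 𝕜)
    {y : (k : ι) → EuclideanSpace 𝕜 (Fin (n k))} (hy : ∀ k, ‖y k‖ = 1) :
    ‖tInner A (rankOne y)‖ ≤ specNorm A :=
  le_csSup (specNorm_bddAbove A) ⟨y, hy, rfl⟩

theorem specNorm_nonneg (A : ((k : ι) → Fin (n k)) → 𝕜) : 0 ≤ specNorm A := by
  refine Real.sSup_nonneg ?_
  rintro _ ⟨y, -, rfl⟩
  exact norm_nonneg _

theorem specNorm_outerVec_le (A : ((k : ι) → Fin (n k)) → 𝕜)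
    (x : (k : κ) → EuclideanSpace 𝕜 (Fin (m k))) :
    specNorm (outerVec A x) ≤ specNorm A * ∏ k, ‖x k‖ := by
  refine Real.sSup_le ?_ (mul_nonneg (specNorm_nonneg A)
    (Finset.prod_nonneg fun _ _ => norm_nonneg _))
  rintro _ ⟨y, hy, rfl⟩
  obtain ⟨u, z, rfl⟩ := exists_eq_joinVec y
  rw [rankOne_joinVec, tInner_outerVec, norm_mul, norm_prod]
  refine mul_le_mul (norm_tInner_rankOne_le_specNorm A fun k => hy (Sum.inl k))
    (Finset.prod_le_prod (fun _ _ => norm_nonneg _) fun k _ => ?_)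
    (Finset.prod_nonneg fun _ _ => norm_nonneg _) (specNorm_nonneg A)
  have hz : ‖z k‖ = 1 := hy (Sum.inr k)
  simpa [hz] using norm_inner_le_norm (𝕜 := 𝕜) (z k) (x k)

theorem le_specNorm_outerVec (A : ((k : ι) → Fin (n k)) → 𝕜)
    (x : (k : κ) → EuclideanSpace 𝕜 (Fin (m k))) :
    specNorm A * ∏ k, ‖x k‖ ≤ specNorm (outerVec A x) := by
  by_cases hx : ∀ k, x k ≠ 0
  · have hc : 0 < ∏ k, ‖x k‖ := Finset.prod_pos fun k _ => norm_pos_iff.2 (hx k)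
    rw [← le_div_iff₀ hc]
    refine Real.sSup_le ?_ (div_nonneg (specNorm_nonneg _) hc.le)
    rintro _ ⟨y, hy, rfl⟩
    rw [le_div_iff₀ hc]
    have hz (k) : ‖((‖x k‖⁻¹ : ℝ) : 𝕜) • x k‖ = 1 := by
      rw [norm_smul, RCLike.norm_ofReal, abs_inv, abs_norm,
        inv_mul_cancel₀ (norm_ne_zero_iff.2 (hx k))]
    have hyz : ∀ k, ‖joinVec y (fun k => ((‖x k‖⁻¹ : ℝ) : 𝕜) • x k) k‖ = 1 := by
      rintro (k | k)
      exacts [hy k, hz k]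
    refine le_of_eq_of_le ?_ (norm_tInner_rankOne_le_specNorm (outerVec A x) hyz)
    rw [rankOne_joinVec, tInner_outerVec, norm_mul, norm_prod]
    congr 1
    refine Finset.prod_congr rfl fun k _ => ?_
    have hk := norm_ne_zero_iff.2 (hx k)
    rw [inner_smul_left, RCLike.conj_ofReal, inner_self_eq_norm_sq_to_K, norm_mul, norm_pow,
      RCLike.norm_ofReal, RCLike.norm_ofReal, abs_inv, abs_norm]
    field_simp
  · push Not at hx
    obtain ⟨k, hk⟩ := hx
    rw [Finset.prod_eq_zero (Finset.mem_univ k) (by rw [hk, norm_zero]), mul_zero]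
    exact specNorm_nonneg _

/-- A scalar can be absorbed into one factor of a rank-one tensor. -/
theorem exists_rankOne_eq_mul (k₀ : ι) (a : 𝕜) (u : (k : ι) → EuclideanSpace 𝕜 (Fin (n k))) :
    ∃ v : (k : ι) → EuclideanSpace 𝕜 (Fin (n k)),
      (∀ j, rankOne v j = rankOne u j * a) ∧ ∏ k, ‖v k‖ = (∏ k, ‖u k‖) * ‖a‖ := by
  refine ⟨fun k => (if k = k₀ then a else 1) • u k, fun j => ?_, ?_⟩
  · simp only [rankOne, PiLp.smul_apply, smul_eq_mul, Finset.prod_mul_distrib]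
    simp [mul_comm]
  · simp only [norm_smul, Finset.prod_mul_distrib]
    simp [apply_ite norm, mul_comm]

omit [DecidableEq ι] in
theorem nucNorm_bddBelow (A : ((k : ι) → Fin (n k)) → 𝕜) :
    BddBelow { s : ℝ | ∃ (r : ℕ) (x : Fin r → (k : ι) → EuclideanSpace 𝕜 (Fin (n k))),
      A = (∑ i, rankOne (x i)) ∧ s = ∑ i, ∏ k, ‖x i k‖ } := by
  refine ⟨0, ?_⟩
  rintro _ ⟨r, y, -, rfl⟩
  exact Finset.sum_nonneg fun _ _ => Finset.prod_nonneg fun _ _ => norm_nonneg _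

theorem nucNorm_le (A : ((k : ι) → Fin (n k)) → 𝕜) {r : ℕ}
    (y : Fin r → (k : ι) → EuclideanSpace 𝕜 (Fin (n k))) (h : A = ∑ i, rankOne (y i)) :
    nucNorm A ≤ ∑ i, ∏ k, ‖y i k‖ :=
  csInf_le (nucNorm_bddBelow A) ⟨r, y, h, rfl⟩

theorem nucNorm_nonneg (A : ((k : ι) → Fin (n k)) → 𝕜) : 0 ≤ nucNorm A := by
  refine Real.sInf_nonneg ?_
  rintro _ ⟨r, y, -, rfl⟩
  exact Finset.sum_nonneg fun _ _ => Finset.prod_nonneg fun _ _ => norm_nonneg _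

omit [DecidableEq ι] [DecidableEq κ] in
theorem outerVec_sum_rankOne {r : ℕ} (y : Fin r → (k : ι) → EuclideanSpace 𝕜 (Fin (n k)))
    (x : (k : κ) → EuclideanSpace 𝕜 (Fin (m k))) :
    outerVec (∑ i, rankOne (y i)) x = ∑ i, rankOne (joinVec (y i) x) := by
  funext j
  obtain ⟨p, rfl⟩ := (splitIndex n m).symm.surjective j
  simp only [rankOne_joinVec, Finset.sum_apply, outerVec_splitIndex_symm, Finset.sum_mul]

/-- Contracting a rank-one decomposition of `A ⊗ x₁ ⊗ ⋯ ⊗ x_e` with the dual vectors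
`x_k / ‖x_k‖²` gives a rank-one decomposition of `A` of no larger cost. -/
theorem exists_decomposition_of_outerVec (k₀ : ι) (A : ((k : ι) → Fin (n k)) → 𝕜)
    {x : (k : κ) → EuclideanSpace 𝕜 (Fin (m k))} (hx : ∀ k, x k ≠ 0) {r : ℕ}
    (y : Fin r → (k : ι ⊕ κ) → EuclideanSpace 𝕜 (Fin (Sum.elim n m k)))
    (h : outerVec A x = ∑ i, rankOne (y i)) :
    ∃ v : Fin r → (k : ι) → EuclideanSpace 𝕜 (Fin (n k)), A = ∑ i, rankOne (v i) ∧
      (∑ i, ∏ k, ‖v i k‖) * ∏ k, ‖x k‖ ≤ ∑ i, ∏ k, ‖y i k‖ := by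
  choose u z huz using fun i => exists_eq_joinVec (y i)
  obtain rfl : y = fun i => joinVec (u i) (z i) := funext huz
  let w (k : κ) : EuclideanSpace 𝕜 (Fin (m k)) := (((‖x k‖ ^ 2)⁻¹ : ℝ) : 𝕜) • x k
  have hwx (k) : inner 𝕜 (w k) (x k) = (1 : 𝕜) := by
    have hk : ((‖x k‖ : ℝ) : 𝕜) ≠ 0 := RCLike.ofReal_ne_zero.2 (norm_ne_zero_iff.2 (hx k))
    simp only [w]
    rw [inner_smul_left, RCLike.conj_ofReal, inner_self_eq_norm_sq_to_K]
    push_cast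
    exact inv_mul_cancel₀ (pow_ne_zero 2 hk)
  have hw (k) : ‖w k‖ * ‖x k‖ = 1 := by
    have hk := norm_ne_zero_iff.2 (hx k)
    simp only [w]
    rw [norm_smul, RCLike.norm_ofReal, abs_of_nonneg (by positivity)]
    field_simp
  choose v hv hvn using fun i => exists_rankOne_eq_mul k₀ (∏ k, inner 𝕜 (w k) (z i k)) (u i)
  refine ⟨v, ?_, ?_⟩
  · funext j
    have hj (l : (k : κ) → Fin (m k)) :
        A j * rankOne x l = ∑ i, rankOne (u i) j * rankOne (z i) l := by
      have := congrFun h ((splitIndex n m).symm (j, l))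
      simpa only [Finset.sum_apply, rankOne_joinVec, outerVec_splitIndex_symm] using this
    calc A j = A j * ∏ k, inner 𝕜 (w k) (x k) := by simp [hwx]
      _ = ∑ l, A j * rankOne x l * (starRingEnd 𝕜) (rankOne w l) := by
        simp only [← sum_rankOne_mul_conj, Finset.mul_sum, mul_assoc]
      _ = ∑ i, rankOne (u i) j * ∏ k, inner 𝕜 (w k) (z i k) := by
        simp only [hj, ← sum_rankOne_mul_conj, Finset.mul_sum, Finset.sum_mul, mul_assoc]
        exact Finset.sum_comm
      _ = (∑ i, rankOne (v i)) j := by simp only [Finset.sum_apply, hv]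
  · rw [Finset.sum_mul]
    refine Finset.sum_le_sum fun i _ => ?_
    rw [hvn, prod_norm_joinVec, mul_assoc, norm_prod, ← Finset.prod_mul_distrib]
    refine mul_le_mul_of_nonneg_left ?_ (Finset.prod_nonneg fun _ _ => norm_nonneg _)
    refine Finset.prod_le_prod (fun _ _ => by positivity) fun k _ => ?_
    calc ‖inner 𝕜 (w k) (z i k)‖ * ‖x k‖ ≤ ‖w k‖ * ‖z i k‖ * ‖x k‖ := by
          gcongr
          exact norm_inner_le_norm _ _
      _ = ‖z i k‖ := by rw [mul_right_comm, hw, one_mul]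

theorem nucNorm_outerVec [Nonempty ι] (A : ((k : ι) → Fin (n k)) → 𝕜)
    (x : (k : κ) → EuclideanSpace 𝕜 (Fin (m k))) :
    nucNorm (outerVec A x) = nucNorm A * ∏ k, ‖x k‖ := by
  by_cases hx : ∀ k, x k ≠ 0
  · have hc : 0 < ∏ k, ‖x k‖ := Finset.prod_pos fun k _ => norm_pos_iff.2 (hx k)
    have k₀ : ι := Classical.arbitrary ι
    rcases Set.eq_empty_or_nonempty { s : ℝ | ∃ (r : ℕ)
        (y : Fin r → (k : ι) → EuclideanSpace 𝕜 (Fin (n k))),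
        A = (∑ i, rankOne (y i)) ∧ s = ∑ i, ∏ k, ‖y i k‖ } with hS | hS
    · have hS' : { s : ℝ | ∃ (r : ℕ)
          (y : Fin r → (k : ι ⊕ κ) → EuclideanSpace 𝕜 (Fin (Sum.elim n m k))),
          outerVec A x = (∑ i, rankOne (y i)) ∧ s = ∑ i, ∏ k, ‖y i k‖ } = ∅ := by
        rw [Set.eq_empty_iff_forall_notMem]
        rintro _ ⟨r, y, hy, rfl⟩
        obtain ⟨v, hv, -⟩ := exists_decomposition_of_outerVec k₀ A hx y hy
        exact Set.eq_empty_iff_forall_notMem.1 hS _ ⟨r, v, hv, rfl⟩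
      rw [nucNorm, nucNorm, hS, hS', Real.sInf_empty, zero_mul]
    · refine le_antisymm ?_ ?_
      · rw [← div_le_iff₀ hc]
        refine le_csInf hS ?_
        rintro _ ⟨r, y, rfl, rfl⟩
        rw [div_le_iff₀ hc, Finset.sum_mul]
        simpa only [prod_norm_joinVec] using nucNorm_le _ _ (outerVec_sum_rankOne y x)
      · obtain ⟨_, r, y, hy, -⟩ := hS
        refine le_csInf ⟨_, r, fun i => joinVec (y i) x, ?_, rfl⟩ ?_
        · rw [hy, outerVec_sum_rankOne]
        · rintro _ ⟨r, y, hy, rfl⟩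
          obtain ⟨v, hv, hle⟩ := exists_decomposition_of_outerVec k₀ A hx y hy
          exact (mul_le_mul_of_nonneg_right (nucNorm_le A v hv) hc.le).trans hle
  · push Not at hx
    obtain ⟨k, hk⟩ := hx
    rw [Finset.prod_eq_zero (Finset.mem_univ k) (by rw [hk, norm_zero]), mul_zero]
    have hA : outerVec A x = 0 := by
      funext j
      rw [outerVec, Finset.prod_eq_zero (Finset.mem_univ k) (by rw [hk]; rfl), mul_zero,
        Pi.zero_apply]
    refine le_antisymm ?_ (nucNorm_nonneg _)
    simpa using nucNorm_le (outerVec A x) (r := 0) Fin.elim0 (by simpa using hA)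

end TensorProducts

/-- Proposition 2.1: tensoring with vectors multiplies the spectral and nuclear norms by
the product of the vectors' `l²` norms. -/
theorem stmt0 {d e : ℕ} (hd : 0 < d) {n : Fin d → ℕ} {m : Fin e → ℕ}
    (A : ((k : Fin d) → Fin (n k)) → 𝕜)
    (x : (k : Fin e) → EuclideanSpace 𝕜 (Fin (m k))) :
    specNorm (fun i : (k : Fin d ⊕ Fin e) → Fin (Sum.elim n m k) =>
        A (fun k => i (Sum.inl k)) * ∏ k, x k (i (Sum.inr k)))
      = specNorm A * ∏ k, ‖x k‖ ∧
    nucNorm (fun i : (k : Fin d ⊕ Fin e) → Fin (Sum.elim n m k) =>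
        A (fun k => i (Sum.inl k)) * ∏ k, x k (i (Sum.inr k)))
      = nucNorm A * ∏ k, ‖x k‖ := by
  have : Nonempty (Fin d) := ⟨⟨0, hd⟩⟩
  exact ⟨le_antisymm (specNorm_outerVec_le A x) (le_specNorm_outerVec A x), nucNorm_outerVec A x⟩
end
end

section
/- Let F be ℝ or ℂ and suppose A ∈ F^{n₁×⋯×n_d} has an orthogonal decomposition A = Σ_{i=1}^r λ_i u_{1,i}⊗⋯⊗u_{d,i}, where for each k the vectors u_{k,1},…,u_{k,r} ∈ F^{n_k} are orthonormal, i.e., ⟨u_{k,i}, u_{k,j}⟩ = δ_{ij}. Then ‖A‖ = (Σ_{i=1}^r |λ_i|²)^{1/2}, ‖A‖_{σ,F} = max_{i=1,…,r} |λ_i|, and ‖A‖_{*,F} = |λ₁| + ⋯ + |λ_r|. -/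
open scoped BigOperators

noncomputable section

variable {𝕜 : Type} [RCLike 𝕜]

/-- The Hilbert–Schmidt norm of a tensor. -/
def hsNorm {ι : Type} [Fintype ι] [DecidableEq ι] {n : ι → ℕ}
    (A : ((k : ι) → Fin (n k)) → 𝕜) : ℝ :=
  Real.sqrt (∑ i, ‖A i‖ ^ 2)

section TensorLemmas

variable {ι : Type} [Fintype ι] [DecidableEq ι] {n : ι → ℕ}

theorem tInner_sum_left {α : Type} (s : Finset α) (B : α → ((k : ι) → Fin (n k)) → 𝕜)
    (C : ((k : ι) → Fin (n k)) → 𝕜) :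
    tInner (∑ a ∈ s, B a) C = ∑ a ∈ s, tInner (B a) C := by
  simp only [tInner, Finset.sum_apply, Finset.sum_mul]
  exact Finset.sum_comm

theorem tInner_sum_right {α : Type} (s : Finset α) (B : ((k : ι) → Fin (n k)) → 𝕜)
    (C : α → ((k : ι) → Fin (n k)) → 𝕜) :
    tInner B (∑ a ∈ s, C a) = ∑ a ∈ s, tInner B (C a) := by
  simp only [tInner, Finset.sum_apply, map_sum, Finset.mul_sum]
  exact Finset.sum_comm

theorem tInner_smul_left (c : 𝕜) (B C : ((k : ι) → Fin (n k)) → 𝕜) :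
    tInner (c • B) C = c * tInner B C := by
  simp only [tInner, Pi.smul_apply, smul_eq_mul, Finset.mul_sum, mul_assoc]

theorem tInner_smul_right (c : 𝕜) (B C : ((k : ι) → Fin (n k)) → 𝕜) :
    tInner B (c • C) = (starRingEnd 𝕜) c * tInner B C := by
  simp only [tInner, Pi.smul_apply, smul_eq_mul, Finset.mul_sum, map_mul, mul_left_comm]

theorem tInner_rankOne (x y : (k : ι) → EuclideanSpace 𝕜 (Fin (n k))) :
    tInner (rankOne x) (rankOne y) = ∏ k, inner 𝕜 (y k) (x k) := by
  simp only [tInner, rankOne, map_prod, ← Finset.prod_mul_distrib, PiLp.inner_apply,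
    RCLike.inner_apply]
  exact (Fintype.prod_sum fun k j => x k j * (starRingEnd 𝕜) (y k j)).symm

theorem tInner_self (A : ((k : ι) → Fin (n k)) → 𝕜) :
    tInner A A = ((∑ i, ‖A i‖ ^ 2 : ℝ) : 𝕜) := by
  simp [tInner, RCLike.mul_conj]

/-- Multilinear Bessel inequality: orthonormal families in at least two modes give rank-one
tensors whose coefficients on `x` are absolutely summable with sum at most `∏ k, ‖x k‖`. -/
theorem sum_prod_norm_inner_le [Nontrivial ι] {r : ℕ}
    {u : (k : ι) → Fin r → EuclideanSpace 𝕜 (Fin (n k))} (hu : ∀ k, Orthonormal 𝕜 (u k))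
    (x : (k : ι) → EuclideanSpace 𝕜 (Fin (n k))) :
    ∑ i, ∏ k, ‖inner 𝕜 (u k i) (x k)‖ ≤ ∏ k, ‖x k‖ := by
  obtain ⟨a, b, hab⟩ := exists_pair_ne ι
  have hb : b ∈ Finset.univ.erase a := by simp [hab.symm]
  have split (f : ι → ℝ) : ∏ k, f k = f a * f b * ∏ k ∈ (Finset.univ.erase a).erase b, f k := by
    rw [mul_assoc, Finset.mul_prod_erase _ f hb, Finset.mul_prod_erase _ f (Finset.mem_univ a)]
  have bessel (k : ι) : √(∑ i, ‖inner 𝕜 (u k i) (x k)‖ ^ 2) ≤ ‖x k‖ :=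
    Real.sqrt_le_iff.2 ⟨norm_nonneg _, (hu k).sum_inner_products_le _⟩
  have hk (i : Fin r) (k : ι) : ‖inner 𝕜 (u k i) (x k)‖ ≤ ‖x k‖ := by
    simpa [(hu k).1 i] using norm_inner_le_norm (𝕜 := 𝕜) (u k i) (x k)
  simp only [split]
  calc
    _ ≤ ∑ i, ‖inner 𝕜 (u a i) (x a)‖ * ‖inner 𝕜 (u b i) (x b)‖ *
          ∏ k ∈ (Finset.univ.erase a).erase b, ‖x k‖ := by
      gcongr with i _ k _
      exact hk i k
    _ ≤ _ := by
      rw [← Finset.sum_mul]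
      gcongr
      exact (Real.sum_mul_le_sqrt_mul_sqrt _ _ _).trans
        (mul_le_mul (bessel a) (bessel b) (Real.sqrt_nonneg _) (norm_nonneg _))

theorem norm_tInner_rankOne_le [Nontrivial ι] {r : ℕ}
    {u : (k : ι) → Fin r → EuclideanSpace 𝕜 (Fin (n k))} (hu : ∀ k, Orthonormal 𝕜 (u k))
    {c : Fin r → 𝕜} {M : ℝ} (hM : 0 ≤ M) (hc : ∀ i, ‖c i‖ ≤ M)
    (x : (k : ι) → EuclideanSpace 𝕜 (Fin (n k))) :
    ‖tInner (∑ i, c i • rankOne fun k => u k i) (rankOne x)‖ ≤ M * ∏ k, ‖x k‖ := by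
  simp only [tInner_sum_left, tInner_smul_left, tInner_rankOne]
  calc
    _ ≤ ∑ i, ‖c i * ∏ k, inner 𝕜 (x k) (u k i)‖ := norm_sum_le _ _
    _ ≤ ∑ i, M * ∏ k, ‖inner 𝕜 (u k i) (x k)‖ := by
      gcongr with i
      simp only [norm_mul, norm_prod, norm_inner_symm (x _)]
      gcongr
      exact hc i
    _ ≤ _ := by
      rw [← Finset.mul_sum]
      gcongr
      exact sum_prod_norm_inner_le hu x

theorem tInner_rankOne_orthonormal [Nonempty ι] {r : ℕ}
    {u : (k : ι) → Fin r → EuclideanSpace 𝕜 (Fin (n k))} (hu : ∀ k, Orthonormal 𝕜 (u k))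
    (i j : Fin r) :
    tInner (rankOne fun k => u k i) (rankOne fun k => u k j) = if i = j then (1 : 𝕜) else 0 := by
  simp only [tInner_rankOne, (orthonormal_iff_ite.1 (hu _)), @eq_comm _ j i]
  split_ifs <;> simp

theorem tInner_orthogonal_sum_rankOne [Nonempty ι] {r : ℕ}
    {u : (k : ι) → Fin r → EuclideanSpace 𝕜 (Fin (n k))} (hu : ∀ k, Orthonormal 𝕜 (u k))
    (c : Fin r → 𝕜) (j : Fin r) :
    tInner (∑ i, c i • rankOne fun k => u k i) (rankOne fun k => u k j) = c j := by
  simp [tInner_sum_left, tInner_smul_left, tInner_rankOne_orthonormal hu]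

theorem tInner_orthogonal_sum [Nonempty ι] {r : ℕ}
    {u : (k : ι) → Fin r → EuclideanSpace 𝕜 (Fin (n k))} (hu : ∀ k, Orthonormal 𝕜 (u k))
    (c e : Fin r → 𝕜) :
    tInner (∑ i, c i • rankOne fun k => u k i) (∑ i, e i • rankOne fun k => u k i) =
      ∑ i, c i * (starRingEnd 𝕜) (e i) := by
  simp only [tInner_sum_right, tInner_smul_right, tInner_orthogonal_sum_rankOne hu, mul_comm]

theorem hsNorm_orthogonal_sum [Nonempty ι] {r : ℕ}
    {u : (k : ι) → Fin r → EuclideanSpace 𝕜 (Fin (n k))} (hu : ∀ k, Orthonormal 𝕜 (u k))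
    (c : Fin r → 𝕜) :
    hsNorm (∑ i, c i • rankOne fun k => u k i) = √(∑ i, ‖c i‖ ^ 2) := by
  have h := tInner_orthogonal_sum hu c c
  rw [tInner_self] at h
  rw [hsNorm]
  congr 1
  exact RCLike.ofReal_injective (K := 𝕜) (by rw [h]; simp [RCLike.mul_conj])

theorem specNorm_orthogonal_sum [Nontrivial ι] {r : ℕ}
    {u : (k : ι) → Fin r → EuclideanSpace 𝕜 (Fin (n k))} (hu : ∀ k, Orthonormal 𝕜 (u k))
    (c : Fin r → 𝕜) :
    specNorm (∑ i, c i • rankOne fun k => u k i) = ⨆ i, ‖c i‖ := by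
  have h0 : 0 ≤ ⨆ i, ‖c i‖ := Real.iSup_nonneg fun _ => norm_nonneg _
  have hub (s : ℝ) (hs : s ∈ { s : ℝ | ∃ x : (k : ι) → EuclideanSpace 𝕜 (Fin (n k)),
      (∀ k, ‖x k‖ = 1) ∧ s = ‖tInner (∑ i, c i • rankOne fun k => u k i) (rankOne x)‖ }) :
      s ≤ ⨆ i, ‖c i‖ := by
    obtain ⟨x, hx, rfl⟩ := hs
    simpa [hx] using norm_tInner_rankOne_le hu h0
      (le_ciSup (Set.finite_range fun i => ‖c i‖).bddAbove) x
  refine le_antisymm (Real.sSup_le hub h0) ?_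
  refine Real.iSup_le (fun i => le_csSup ⟨_, hub⟩ ⟨fun k => u k i, fun k => (hu k).1 i, ?_⟩)
    (Real.sSup_nonneg ?_)
  · rw [tInner_orthogonal_sum_rankOne hu]
  · rintro _ ⟨x, -, rfl⟩
    exact norm_nonneg _

theorem rankOne_update_smul (x : (k : ι) → EuclideanSpace 𝕜 (Fin (n k))) (a : ι) (c : 𝕜) :
    rankOne (Function.update x a (c • x a)) = c • rankOne x := by
  ext i
  simp only [rankOne, Pi.smul_apply, smul_eq_mul]
  rw [← Finset.mul_prod_erase _ _ (Finset.mem_univ a),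
    ← Finset.mul_prod_erase _ (fun k => x k (i k)) (Finset.mem_univ a), ← mul_assoc]
  congr 1
  · simp
  · exact Finset.prod_congr rfl fun k hk => by
      rw [Function.update_of_ne (Finset.ne_of_mem_erase hk)]

theorem prod_norm_update_smul (x : (k : ι) → EuclideanSpace 𝕜 (Fin (n k))) (a : ι) (c : 𝕜) :
    ∏ k, ‖Function.update x a (c • x a) k‖ = ‖c‖ * ∏ k, ‖x k‖ := by
  rw [← Finset.mul_prod_erase _ _ (Finset.mem_univ a),
    ← Finset.mul_prod_erase _ (fun k => ‖x k‖) (Finset.mem_univ a), ← mul_assoc]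
  congr 1
  · simp [norm_smul]
  · exact Finset.prod_congr rfl fun k hk => by
      rw [Function.update_of_ne (Finset.ne_of_mem_erase hk)]

theorem nucNorm_orthogonal_sum [Nontrivial ι] {r : ℕ}
    {u : (k : ι) → Fin r → EuclideanSpace 𝕜 (Fin (n k))} (hu : ∀ k, Orthonormal 𝕜 (u k))
    (c : Fin r → 𝕜) :
    nucNorm (∑ i, c i • rankOne fun k => u k i) = ∑ i, ‖c i‖ := by
  refine IsLeast.csInf_eq ⟨?_, ?_⟩
  · have a : ι := Classical.arbitrary ι
    refine ⟨r, fun i => Function.update (fun k => u k i) a (c i • u a i), ?_, ?_⟩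
    · exact Finset.sum_congr rfl fun i _ => (rankOne_update_smul (fun k => u k i) a (c i)).symm
    · refine Finset.sum_congr rfl fun i _ => ?_
      rw [prod_norm_update_smul (fun k => u k i) a (c i)]
      simp [(hu _).1 i]
  · rintro _ ⟨m, x, hx, rfl⟩
    let e : Fin r → 𝕜 := fun i => c i / (‖c i‖ : 𝕜)
    have he (i : Fin r) : ‖e i‖ ≤ 1 := by
      simpa [e] using div_self_le_one ‖c i‖
    have hec (i : Fin r) : e i * (starRingEnd 𝕜) (c i) = (‖c i‖ : 𝕜) := by
      rw [div_mul_eq_mul_div, RCLike.mul_conj, sq, mul_self_div_self]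
    have key := tInner_orthogonal_sum hu e c
    rw [hx, tInner_sum_right] at key
    simp only [hec] at key
    calc
      ∑ i, ‖c i‖ = ‖∑ i, (‖c i‖ : 𝕜)‖ := by
        rw [← RCLike.ofReal_sum, RCLike.norm_ofReal, abs_of_nonneg (by positivity)]
      _ ≤ ∑ j, ∏ k, ‖x j k‖ := by
        rw [← key]
        exact norm_sum_le_of_le _ fun j _ => by
          simpa using norm_tInner_rankOne_le hu zero_le_one he (x j)

end TensorLemmas

/-- Corollary 4.2: for an orthogonally decomposable tensor
`A = Σᵢ λᵢ u_{1,i} ⊗ ⋯ ⊗ u_{d,i}` with each family `u_{k,1}, …, u_{k,r}` orthonormal,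
the Hilbert–Schmidt, spectral and nuclear norms are given by the `l²`, `l^∞` and `l¹`
norms of `(λ₁, …, λ_r)` respectively. -/
theorem stmt4 {d : ℕ} (hd : 2 ≤ d) {n : Fin d → ℕ} {r : ℕ}
    (A : ((k : Fin d) → Fin (n k)) → 𝕜) (lam : Fin r → 𝕜)
    (u : (k : Fin d) → Fin r → EuclideanSpace 𝕜 (Fin (n k)))
    (horth : ∀ k, Orthonormal 𝕜 (u k))
    (hA : A = ∑ i, lam i • rankOne (fun k => u k i)) :
    hsNorm A = Real.sqrt (∑ i, ‖lam i‖ ^ 2) ∧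
    specNorm A = ⨆ i, ‖lam i‖ ∧
    nucNorm A = ∑ i, ‖lam i‖ := by
  have : Nontrivial (Fin d) := Fin.nontrivial_iff_two_le.2 hd
  subst hA
  exact ⟨hsNorm_orthogonal_sum horth lam, specNorm_orthogonal_sum horth lam,
    nucNorm_orthogonal_sum horth lam⟩
end
end

section
/- Let V be a real vector space of dimension n, let ν : V → [0,∞) be a norm, and let E be the set of extreme points of the unit ball B_ν = {x ∈ V : ν(x) ≤ 1}. If ν(x) = 1, then there exist r ∈ ℕ, scalars λ₁,…,λ_r > 0 with λ₁ + ⋯ + λ_r = 1, and linearly independent points x₁,…,x_r ∈ E such that x = Σ_{i=1}^r λ_i x_i. -/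
open scoped BigOperators

noncomputable section

/-- The directions in which one can move from `x` both ways while staying in the convex
set `A`. -/
def faceDirection {E : Type*} [AddCommGroup E] [Module ℝ E] {A : Set E} (hA : Convex ℝ A)
    {x : E} (hx : x ∈ A) : Submodule ℝ E where
  carrier := {v | ∃ ε > 0, ∀ t : ℝ, |t| ≤ ε → x + t • v ∈ A}
  zero_mem' := ⟨1, one_pos, fun t _ => by simpa using hx⟩
  add_mem' := by
    rintro v w ⟨ε, hε, hv⟩ ⟨δ, hδ, hw⟩
    refine ⟨min ε δ / 2, by positivity, fun t ht => ?_⟩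
    have h2 : |2 * t| ≤ min ε δ := by rw [abs_mul, abs_two]; linarith
    have := hA (hv (2 * t) (h2.trans (min_le_left _ _))) (hw (2 * t) (h2.trans (min_le_right _ _)))
      (show (0 : ℝ) ≤ 1 / 2 by norm_num) (show (0 : ℝ) ≤ 1 / 2 by norm_num) (by norm_num)
    convert this using 1
    module
  smul_mem' := by
    rintro c v ⟨ε, hε, hv⟩
    refine ⟨ε / (|c| + 1), by positivity, fun t ht => ?_⟩
    rw [smul_smul]
    apply hv
    rw [le_div_iff₀ (by positivity)] at ht
    rw [abs_mul]
    nlinarith [abs_nonneg t, abs_nonneg c]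

theorem mem_extremePoints_of_faceDirection_eq_bot {E : Type*} [AddCommGroup E] [Module ℝ E]
    {A : Set E} (hA : Convex ℝ A) {x : E} (hx : x ∈ A) (h : faceDirection hA hx = ⊥) :
    x ∈ A.extremePoints ℝ := by
  rw [mem_extremePoints_iff_left]
  refine ⟨hx, fun a ha b hb hab => ?_⟩
  obtain ⟨p, q, hp, hq, hpq, rfl⟩ := hab
  have hmem : b - a ∈ faceDirection hA hx := by
    refine ⟨min p q, by positivity, fun t ht => ?_⟩
    obtain ⟨h1, h2⟩ := abs_le.1 ht
    have := hA ha hb (show 0 ≤ p - t by linarith [min_le_left p q])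
      (show 0 ≤ q + t by linarith [min_le_right p q]) (by linarith)
    convert this using 1
    module
  rw [h, Submodule.mem_bot, sub_eq_zero] at hmem
  rw [hmem, ← add_smul, hpq, one_smul]

/-- Moving from `x` along a face direction until the boundary of the compact convex set `A`
strictly shrinks the space of face directions. -/
theorem exists_faceDirection_lt {E : Type*} [NormedAddCommGroup E] [NormedSpace ℝ E]
    {A : Set E} (hA : Convex ℝ A) (hc : IsCompact A) {x : E} (hx : x ∈ A) {v : E}
    (hv : v ∈ faceDirection hA hx) (hv0 : v ≠ 0) :
    ∃ t : ℝ, 0 < t ∧ ∃ hy : x + t • v ∈ A, faceDirection hA hy < faceDirection hA hx := by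
  obtain ⟨ε, hε, hmove⟩ := id hv
  have hemb : Topology.IsClosedEmbedding (fun t : ℝ => x + t • v) :=
    (Homeomorph.addLeft x).isClosedEmbedding.comp (isClosedEmbedding_smul_left hv0)
  obtain ⟨t, htA, htmax⟩ := (hemb.isCompact_preimage hc).exists_isGreatest
    ⟨0, by simpa using hx⟩
  have htε : ε ≤ t := htmax (hmove ε (abs_of_pos hε).le)
  have ht : 0 < t := hε.trans_le htε
  refine ⟨t, ht, htA, lt_of_le_of_ne ?_ fun heq => ?_⟩
  · rintro w ⟨δ, hδ, hw⟩
    refine ⟨δ * ε / (ε + t), by positivity, fun s hs => ?_⟩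
    have hs' : |s * ((ε + t) / ε)| ≤ δ := by
      rw [abs_mul, abs_of_pos (show 0 < (ε + t) / ε by positivity)]
      rw [le_div_iff₀ (by positivity)] at hs
      rw [← mul_div_assoc, div_le_iff₀ hε]
      exact hs
    have := hA (hw _ hs') (hmove (-ε) (by rw [abs_neg, abs_of_pos hε]))
      (show 0 ≤ ε / (ε + t) by positivity) (show 0 ≤ t / (ε + t) by positivity)
      (by field_simp)
    convert this using 1
    match_scalars <;> field_simp
    ring
  · obtain ⟨δ, hδ, hw⟩ := heq ▸ hv
    have := htmax (a := t + δ) (by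
      have := hw δ (abs_of_pos hδ).le
      rwa [add_assoc, ← add_smul] at this)
    linarith

/-- **Minkowski's theorem**: a compact convex set in a finite-dimensional space is contained in
the convex hull of its extreme points. -/
theorem mem_convexHull_extremePoints {E : Type*} [NormedAddCommGroup E] [NormedSpace ℝ E]
    [FiniteDimensional ℝ E] {A : Set E} (hA : Convex ℝ A) (hc : IsCompact A) {x : E}
    (hx : x ∈ A) : x ∈ convexHull ℝ (A.extremePoints ℝ) := by
  induction hd : Module.finrank ℝ (faceDirection hA hx) using Nat.strong_induction_on
    generalizing x with
  | _ d ih =>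
    by_cases hbot : faceDirection hA hx = ⊥
    · exact subset_convexHull ℝ _ (mem_extremePoints_of_faceDirection_eq_bot hA hx hbot)
    obtain ⟨v, hv, hv0⟩ := Submodule.exists_mem_ne_zero_of_ne_bot hbot
    obtain ⟨t, ht, hy, hylt⟩ := exists_faceDirection_lt hA hc hx hv hv0
    obtain ⟨s, hs, hz, hzlt⟩ := exists_faceDirection_lt hA hc hx (neg_mem hv) (neg_ne_zero.2 hv0)
    have hY := ih _ (hd ▸ Submodule.finrank_lt_finrank_of_lt hylt) hy rfl
    have hZ := ih _ (hd ▸ Submodule.finrank_lt_finrank_of_lt hzlt) hz rfl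
    have := convex_convexHull ℝ _ hY hZ (show 0 ≤ s / (s + t) by positivity)
      (show 0 ≤ t / (s + t) by positivity) (by field_simp)
    convert this using 1
    match_scalars <;> field_simp
    ring

/-- An affinely independent family lying in a hyperplane `f = 1` is linearly independent. -/
theorem AffineIndependent.linearIndependent_of_map_eq_one {ι E : Type*} [AddCommGroup E]
    [Module ℝ E] {y : ι → E} (hy : AffineIndependent ℝ y) (f : E →ₗ[ℝ] ℝ)
    (hf : ∀ i, f (y i) = 1) : LinearIndependent ℝ y := by
  rw [linearIndependent_iff']
  intro s c hc
  refine affineIndependent_iff.1 hy s c ?_ hc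
  simpa [hf] using congrArg f hc

/-- Proposition 4.3 (first part): in a finite-dimensional real normed space, every vector
of norm one is a convex combination of finitely many linearly independent extreme points
of the closed unit ball. -/
theorem stmt5 {V : Type} [NormedAddCommGroup V] [NormedSpace ℝ V] [FiniteDimensional ℝ V]
    (n : ℕ) (hn : Module.finrank ℝ V = n) (x : V) (hx : ‖x‖ = 1) :
    ∃ (r : ℕ) (lam : Fin r → ℝ) (y : Fin r → V),
      (∀ i, 0 < lam i) ∧ (∑ i, lam i) = 1 ∧
      (∀ i, y i ∈ Set.extremePoints ℝ (Metric.closedBall (0 : V) 1)) ∧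
      LinearIndependent ℝ y ∧ x = ∑ i, lam i • y i := by
  obtain ⟨ι, _, z, w, hz, hind, hw, hw1, hsum⟩ := eq_pos_convex_span_of_mem_convexHull
    (mem_convexHull_extremePoints (convex_closedBall (0 : V) 1) (isCompact_closedBall 0 1)
      (x := x) (by simp [hx]))
  obtain ⟨f, hf, hfx⟩ := exists_dual_vector'' ℝ x
  have hle : ∀ i, f (z i) ≤ 1 := fun i => by
    have hzi : ‖z i‖ ≤ 1 := by
      simpa using extremePoints_subset (hz (Set.mem_range_self i))
    calc f (z i) ≤ ‖f (z i)‖ := Real.le_norm_self _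
      _ ≤ ‖f‖ * ‖z i‖ := f.le_opNorm _
      _ ≤ 1 := mul_le_one₀ hf (norm_nonneg _) hzi
  have hfsum : ∑ i, w i * f (z i) = ∑ i, w i := by
    rw [hw1, ← show f x = 1 by simpa [hx] using hfx, ← hsum]
    simp
  have hone : ∀ i, f (z i) = 1 := fun i => by
    have := (Finset.sum_eq_sum_iff_of_le
      fun i _ => mul_le_of_le_one_right (hw i).le (hle i)).1 hfsum i (Finset.mem_univ i)
    exact (mul_eq_left₀ (hw i).ne').1 this
  let e := (Fintype.equivFin ι).symm
  refine ⟨Fintype.card ι, w ∘ e, z ∘ e, fun i => hw _, ?_, fun i => hz (Set.mem_range_self _),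
    (hind.linearIndependent_of_map_eq_one f.toLinearMap hone).comp e e.injective, ?_⟩
  · rw [← hw1]
    exact e.sum_comp w
  · rw [← hsum]
    exact (e.sum_comp fun i => w i • z i).symm
end
end

section
/- Let V be a real vector space of dimension n, let ν : V → [0,∞) be a norm, and let E be the set of extreme points of the unit ball B_ν = {x ∈ V : ν(x) ≤ 1}. Then for every x ∈ V, ν(x) = min{ Σ_{i=1}^n |λ_i| : x = Σ_{i=1}^n λ_i x_i, with x₁,…,x_n ∈ E linearly independent }, and the minimum is attained. -/
open scoped BigOperators

noncomputable section

/-- The directions in which one can move from `x` both ways while staying in the convex set `s`. -/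
def facialDirections {V : Type*} [AddCommGroup V] [Module ℝ V] {s : Set V} (hs : Convex ℝ s)
    {x : V} (hx : x ∈ s) : Submodule ℝ V where
  carrier := {v | ∃ ε : ℝ, 0 < ε ∧ ∀ t : ℝ, |t| ≤ ε → x + t • v ∈ s}
  zero_mem' := ⟨1, one_pos, fun t _ => by simpa using hx⟩
  add_mem' := by
    rintro v w ⟨ε, hε, hv⟩ ⟨δ, hδ, hw⟩
    refine ⟨min ε δ / 2, by positivity, fun t ht => ?_⟩
    have h2 : |2 * t| ≤ min ε δ := by rw [abs_mul, abs_two]; linarith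
    have := hs (hv _ (h2.trans (min_le_left _ _))) (hw _ (h2.trans (min_le_right _ _)))
      (a := 1 / 2) (b := 1 / 2) (by norm_num) (by norm_num) (by norm_num)
    convert this using 1
    module
  smul_mem' := by
    rintro c v ⟨ε, hε, hv⟩
    refine ⟨ε / (|c| + 1), by positivity, fun t ht => ?_⟩
    rw [smul_smul]
    apply hv
    rw [le_div_iff₀ (by positivity)] at ht
    rw [abs_mul]
    nlinarith [abs_nonneg t]

theorem mem_extremePoints_of_facialDirections_eq_bot {V : Type*} [AddCommGroup V] [Module ℝ V]
    {s : Set V} (hs : Convex ℝ s) {x : V} (hx : x ∈ s) (h : facialDirections hs hx = ⊥) :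
    x ∈ s.extremePoints ℝ := by
  refine mem_extremePoints_iff_left.2 ⟨hx, ?_⟩
  rintro a ha b hb ⟨p, q, hp, hq, hpq, rfl⟩
  have hmem : b - a ∈ facialDirections hs hx := by
    refine ⟨min p q, lt_min hp hq, fun t ht => ?_⟩
    obtain ⟨h1, h2⟩ := abs_le.1 ht
    have := hs ha hb (a := p - t) (b := q + t) (by linarith [min_le_left p q])
      (by linarith [min_le_right p q]) (by linarith)
    convert this using 1
    module
  rw [h, Submodule.mem_bot, sub_eq_zero] at hmem
  rw [hmem, ← add_smul, hpq, one_smul]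

theorem facialDirections_le {V : Type*} [AddCommGroup V] [Module ℝ V] {s : Set V}
    (hs : Convex ℝ s) {x y z : V} (hx : x ∈ s) (hy : y ∈ s) (hz : z ∈ s) {a b : ℝ} (ha : 0 < a)
    (hb : 0 ≤ b) (hab : a + b = 1) (h : x = a • y + b • z) :
    facialDirections hs hy ≤ facialDirections hs hx := by
  rintro v ⟨ε, hε, hv⟩
  refine ⟨a * ε, by positivity, fun t ht => ?_⟩
  have hta : |t / a| ≤ ε := by
    rw [abs_div, abs_of_pos ha, div_le_iff₀ ha]
    linarith
  convert hs (hv _ hta) hz ha.le hb hab using 1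
  rw [h, smul_add, smul_smul, mul_div_cancel₀ _ ha.ne']
  abel

/-- Moving in a facial direction, one eventually exits a compact set, and loses this direction. -/
theorem exists_add_smul_notMem_facialDirections {V : Type*} [NormedAddCommGroup V]
    [NormedSpace ℝ V] {s : Set V} (hc : IsCompact s) (hs : Convex ℝ s) {x v : V} (hx : x ∈ s)
    (hv : v ∈ facialDirections hs hx) (hv0 : v ≠ 0) :
    ∃ t : ℝ, 0 < t ∧ ∃ hy : x + t • v ∈ s, v ∉ facialDirections hs hy := by
  obtain ⟨ε, hε, h⟩ := hv
  have hε' : x + ε • v ∈ s := h ε (abs_of_pos hε).le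
  have hcomp : IsCompact {t : ℝ | x + t • v ∈ s} :=
    ((Homeomorph.addLeft x).isClosedEmbedding.comp
      (isClosedEmbedding_smul_left hv0)).isCompact_preimage hc
  obtain ⟨t, ht, hmax⟩ := hcomp.exists_isGreatest ⟨ε, hε'⟩
  refine ⟨t, hε.trans_le (hmax hε'), ht, ?_⟩
  rintro ⟨δ, hδ, hd⟩
  have := hd δ (abs_of_pos hδ).le
  rw [add_assoc, ← add_smul] at this
  linarith [hmax this]

/-- **Minkowski's theorem**: a compact convex set in a finite-dimensional space is contained in the
convex hull of its extreme points. -/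
theorem IsCompact.subset_convexHull_extremePoints {V : Type*} [NormedAddCommGroup V]
    [NormedSpace ℝ V] [FiniteDimensional ℝ V] {s : Set V} (hc : IsCompact s) (hs : Convex ℝ s) :
    s ⊆ convexHull ℝ (s.extremePoints ℝ) := by
  suffices H : ∀ (d : ℕ) (x : V) (hx : x ∈ s),
      Module.finrank ℝ (facialDirections hs hx) = d → x ∈ convexHull ℝ (s.extremePoints ℝ) from
    fun x hx => H _ x hx rfl
  intro d
  induction d using Nat.strong_induction_on with
  | _ d ih =>
  intro x hx hd
  by_cases hbot : facialDirections hs hx = ⊥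
  · exact subset_convexHull _ _ (mem_extremePoints_of_facialDirections_eq_bot hs hx hbot)
  obtain ⟨v, hv, hv0⟩ := Submodule.exists_mem_ne_zero_of_ne_bot hbot
  obtain ⟨t, ht, hy, hvy⟩ := exists_add_smul_notMem_facialDirections hc hs hx hv hv0
  obtain ⟨u, hu, hz, hvz⟩ := exists_add_smul_notMem_facialDirections hc hs hx
    (neg_mem hv) (neg_ne_zero.2 hv0)
  have hsum : u / (t + u) + t / (t + u) = 1 := by field_simp; ring
  have hcomb : x = (u / (t + u)) • (x + t • v) + (t / (t + u)) • (x + u • -v) := by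
    match_scalars <;> field_simp <;> ring
  have hyx := facialDirections_le hs hx hy hz (by positivity) (by positivity) hsum hcomb
  have hzx := facialDirections_le hs hx hz hy (by positivity) (by positivity)
    ((add_comm _ _).trans hsum) (hcomb.trans (add_comm _ _))
  have hy' := ih _ (hd ▸ Submodule.finrank_lt_finrank_of_lt
    (lt_of_le_of_ne hyx fun e => hvy (e ▸ hv))) _ hy rfl
  have hz' := ih _ (hd ▸ Submodule.finrank_lt_finrank_of_lt
    (lt_of_le_of_ne hzx fun e => hvz (e ▸ neg_mem hv))) _ hz rfl
  rw [hcomb]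
  exact convex_convexHull ℝ _ hy' hz' (by positivity) (by positivity) hsum

theorem span_extremePoints_closedBall {V : Type*} [NormedAddCommGroup V] [NormedSpace ℝ V]
    [FiniteDimensional ℝ V] :
    Submodule.span ℝ ((Metric.closedBall (0 : V) 1).extremePoints ℝ) = ⊤ := by
  refine eq_top_iff.2 fun x _ => ?_
  have hmem : ‖x‖⁻¹ • x ∈ Metric.closedBall (0 : V) 1 := by
    rw [mem_closedBall_zero_iff, norm_smul, norm_inv, norm_norm]
    exact inv_mul_le_one
  have h := convexHull_min Submodule.subset_span (Submodule.convex _)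
    ((isCompact_closedBall (0 : V) 1).subset_convexHull_extremePoints (convex_closedBall _ _) hmem)
  rcases eq_or_ne x 0 with rfl | hx
  · exact zero_mem _
  · simpa [smul_smul, hx] using Submodule.smul_mem _ ‖x‖ h

/-- A linearly independent family in a spanning set `s` can be enlarged, inside `s`, to a linearly
independent family indexed by `Fin n`, where `n` is the dimension. -/
theorem LinearIndependent.exists_fin_extension {K V ι : Type*} [DivisionRing K] [AddCommGroup V]
    [Module K V] [FiniteDimensional K V] {n : ℕ} (hn : Module.finrank K V = n) {s : Set V}
    (hs : Submodule.span K s = ⊤) {z : ι → V} (hz : LinearIndependent K z) (hzs : ∀ i, z i ∈ s) :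
    ∃ (y : Fin n → V) (k : ι → Fin n), (∀ i, y i ∈ s) ∧ LinearIndependent K y ∧
      Function.Injective k ∧ ∀ i, y (k i) = z i := by
  obtain ⟨b, hbs, hzb, hsb, hb⟩ :=
    exists_linearIndepOn_id_extension hz.linearIndepOn_id (Set.range_subset_iff.2 hzs)
  have hbtop : ⊤ ≤ Submodule.span K (Set.range ((↑) : b → V)) := by
    rw [Subtype.range_coe, ← hs]
    exact Submodule.span_le.2 hsb
  let B : Module.Basis b K V := Module.Basis.mk (v := ((↑) : b → V)) hb hbtop
  have : Fintype b := FiniteDimensional.fintypeBasisIndex B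
  let e : b ≃ Fin n := Fintype.equivFinOfCardEq (by rw [← Module.finrank_eq_card_basis B, hn])
  refine ⟨fun i => e.symm i, fun i => e ⟨z i, hzb ⟨i, rfl⟩⟩, fun i => hbs (e.symm i).2,
    LinearIndependent.comp (v := ((↑) : b → V)) hb e.symm e.symm.injective, fun i j hij => ?_,
    fun i => by simp⟩
  exact hz.injective (congrArg Subtype.val (e.injective hij))

/-- A nonzero vector is a combination, with positive weights summing to its norm, of linearly
independent extreme points of the unit ball. -/
theorem exists_linearIndependent_extremePoints.{u} {V : Type u} [NormedAddCommGroup V]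
    [NormedSpace ℝ V] [FiniteDimensional ℝ V] {x : V} (hx : x ≠ 0) :
    ∃ (ι : Type u) (_ : Fintype ι) (z : ι → V) (w : ι → ℝ),
      (∀ i, z i ∈ (Metric.closedBall (0 : V) 1).extremePoints ℝ) ∧ LinearIndependent ℝ z ∧
      (∀ i, 0 < w i) ∧ ∑ i, w i = ‖x‖ ∧ ∑ i, w i • z i = x := by
  have hx' : 0 < ‖x‖ := norm_pos_iff.2 hx
  have hmem : ‖x‖⁻¹ • x ∈ Metric.closedBall (0 : V) 1 := by
    rw [mem_closedBall_zero_iff, norm_smul, norm_inv, norm_norm]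
    exact inv_mul_le_one
  obtain ⟨ι, _, z, w, hz, haff, hw, hw1, hwx⟩ := eq_pos_convex_span_of_mem_convexHull
    ((isCompact_closedBall (0 : V) 1).subset_convexHull_extremePoints (convex_closedBall _ _) hmem)
  have hz' : ∀ i, z i ∈ (Metric.closedBall (0 : V) 1).extremePoints ℝ := fun i => hz ⟨i, rfl⟩
  obtain ⟨f, hf, hfx⟩ := exists_dual_vector ℝ x hx'.ne'
  have hfz_le : ∀ i, f (z i) ≤ 1 := fun i => by
    have h1 := f.le_opNorm (z i)
    have h2 := mem_closedBall_zero_iff.1 (extremePoints_subset (hz' i))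
    rw [hf, one_mul] at h1
    exact (le_abs_self _).trans (h1.trans h2)
  have hsum : ∑ i, w i * f (z i) = ∑ i, w i := by
    have := congrArg f hwx
    simp only [map_sum, map_smul, smul_eq_mul, hfx] at this
    rw [this, hw1]
    simp [hx'.ne']
  have hfz : ∀ i, f (z i) = 1 := fun i => by
    have := (Finset.sum_eq_sum_iff_of_le fun i _ =>
      mul_le_of_le_one_right (hw i).le (hfz_le i)).1 hsum i (Finset.mem_univ i)
    exact (mul_eq_left₀ (hw i).ne').1 this
  have hlin : LinearIndependent ℝ z := by
    refine Fintype.linearIndependent_iff.2 fun c hc i => ?_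
    refine affineIndependent_iff.1 haff Finset.univ c ?_ hc i (Finset.mem_univ i)
    simpa [hfz] using congrArg f hc
  refine ⟨ι, inferInstance, z, fun i => ‖x‖ * w i, hz', hlin, fun i => mul_pos hx' (hw i), ?_, ?_⟩
  · rw [← Finset.mul_sum, hw1, mul_one]
  · simp_rw [mul_smul]
    rw [← Finset.smul_sum, hwx, smul_inv_smul₀ hx'.ne']

/-- Proposition 4.3 (second part): in a finite-dimensional real normed space `V` of
dimension `n`, the norm of any `x ∈ V` is the minimum of `Σ |λ_i|` over all
decompositions `x = Σ_{i=1}^n λ_i x_i` with `x₁, …, x_n` linearly independent extreme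
points of the closed unit ball; moreover the minimum is attained. -/
theorem stmt6 {V : Type} [NormedAddCommGroup V] [NormedSpace ℝ V] [FiniteDimensional ℝ V]
    (n : ℕ) (hn : Module.finrank ℝ V = n) (x : V) :
    IsLeast { s : ℝ | ∃ (lam : Fin n → ℝ) (y : Fin n → V),
      (∀ i, y i ∈ Set.extremePoints ℝ (Metric.closedBall (0 : V) 1)) ∧
      LinearIndependent ℝ y ∧ x = ∑ i, lam i • y i ∧ s = ∑ i, |lam i| } ‖x‖ := by
  constructor
  · rcases eq_or_ne x 0 with rfl | hx
    · obtain ⟨y, -, hy, hlin, -⟩ := (linearIndependent_empty_type (R := ℝ)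
        (v := (Empty.elim : Empty → V))).exists_fin_extension hn
        span_extremePoints_closedBall (fun i => i.elim)
      exact ⟨0, y, hy, hlin, by simp, by simp⟩
    · obtain ⟨ι, _, z, w, hz, hzlin, hw, hw1, hwx⟩ := exists_linearIndependent_extremePoints hx
      obtain ⟨y, k, hy, hlin, hk, hyk⟩ :=
        hzlin.exists_fin_extension hn span_extremePoints_closedBall hz
      have hout : ∀ i ∉ Set.range k, Function.extend k w (0 : Fin n → ℝ) i = 0 := fun i hi =>
        Function.extend_apply' w (0 : Fin n → ℝ) i hi
      refine ⟨Function.extend k w (0 : Fin n → ℝ), y, hy, hlin, ?_, ?_⟩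
      · rw [← hwx]
        refine Fintype.sum_of_injective k hk _ _ (fun i hi => ?_) fun i => ?_
        · rw [hout i hi, zero_smul]
        · rw [hk.extend_apply, hyk]
      · rw [← hw1]
        refine Fintype.sum_of_injective k hk _ _ (fun i hi => ?_) fun i => ?_
        · rw [hout i hi, abs_zero]
        · rw [hk.extend_apply, abs_of_pos (hw i)]
  · rintro _ ⟨lam, y, hy, -, rfl, rfl⟩
    refine norm_sum_le_of_le _ fun i _ => ?_
    rw [norm_smul, Real.norm_eq_abs]
    exact mul_le_of_le_one_right (abs_nonneg _)
      (mem_closedBall_zero_iff.1 (extremePoints_subset (hy i)))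
end
end

section
/- Let V be a real vector space of dimension n and ν : V → [0,∞) a norm whose unit ball B_ν has a compact set E of extreme points. For x ∈ V define the nuclear rank rank_ν(x) as the minimum r ∈ ℕ such that x = λ₁x₁ + ⋯ + λ_r x_r with λ_i > 0, x_i ∈ E, and ν(x) = λ₁ + ⋯ + λ_r (with rank_ν(0) = 0). Then rank_ν is upper semicontinuous: if (x_m) is a sequence in V converging to x and rank_ν(x_m) ≤ r for all m, then rank_ν(x) ≤ r. -/
open scoped BigOperators

noncomputable section

/-- The nuclear rank of `x` with respect to the norm of `V`: the least `r` such that `x`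
admits a nuclear decomposition `x = Σ_{i=1}^r λ_i x_i` with `λ_i > 0`, the `x_i` extreme
points of the closed unit ball, and `‖x‖ = Σ λ_i`.  (For `x = 0` the empty decomposition
gives nuclear rank `0`.) -/
noncomputable def nuclearRank {V : Type} [NormedAddCommGroup V] [NormedSpace ℝ V]
    (x : V) : ℕ :=
  sInf { r : ℕ | ∃ (lam : Fin r → ℝ) (y : Fin r → V),
    (∀ i, 0 < lam i) ∧
    (∀ i, y i ∈ Set.extremePoints ℝ (Metric.closedBall (0 : V) 1)) ∧
    x = ∑ i, lam i • y i ∧ ‖x‖ = ∑ i, lam i }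

/-- A combination with nonnegative weights over a finite type can be padded with zero weights
to a combination over `Fin N`. -/
theorem exists_fin_combination_of_card_le {V ι : Type*} [AddCommGroup V] [Module ℝ V] [Fintype ι]
    {s : Set V} (hs : s.Nonempty) {N : ℕ} (hN : Fintype.card ι ≤ N) {w : ι → ℝ} {z : ι → V}
    (hw : ∀ i, 0 ≤ w i) (hz : ∀ i, z i ∈ s) :
    ∃ (w' : Fin N → ℝ) (z' : Fin N → V), (∀ i, 0 ≤ w' i) ∧ (∀ i, z' i ∈ s) ∧
      ∑ i, w' i = ∑ i, w i ∧ ∑ i, w' i • z' i = ∑ i, w i • z i := by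
  obtain ⟨a, ha⟩ := hs
  obtain ⟨f⟩ : Nonempty (ι ↪ Fin N) :=
    Function.Embedding.nonempty_of_card_le (by simpa using hN)
  have hval (j : Fin N) : 0 ≤ Function.extend f w 0 j ∧ Function.extend f z (fun _ ↦ a) j ∈ s := by
    by_cases hj : ∃ i, f i = j
    · obtain ⟨i, rfl⟩ := hj
      simpa only [f.injective.extend_apply] using ⟨hw i, hz i⟩
    · simpa [Function.extend_apply' _ _ _ hj] using ha
  refine ⟨Function.extend f w 0, Function.extend f z fun _ ↦ a, fun j ↦ (hval j).1,
    fun j ↦ (hval j).2, ?_, ?_⟩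
  · refine (Fintype.sum_of_injective f f.injective _ _ (fun j hj ↦ ?_) fun i ↦ ?_).symm
    · exact Function.extend_apply' _ _ _ hj
    · exact (f.injective.extend_apply _ _ _).symm
  · refine (Fintype.sum_of_injective f f.injective _ _ (fun j hj ↦ ?_) fun i ↦ ?_).symm
    · simp [Function.extend_apply' w _ j hj]
    · simp only [f.injective.extend_apply]

/-- In finite dimension, the convex hull of a compact set is closed. -/
theorem IsCompact.isClosed_convexHull_of_finiteDimensional {V : Type*} [NormedAddCommGroup V]
    [NormedSpace ℝ V] [FiniteDimensional ℝ V] {s : Set V} (hs : IsCompact s) :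
    IsClosed (convexHull ℝ s) := by
  rcases s.eq_empty_or_nonempty with rfl | hne
  · simp
  let N := Module.finrank ℝ V + 1
  let Φ : (Fin N → ℝ) × (Fin N → V) → V := fun p ↦ ∑ i, p.1 i • p.2 i
  have hΦ : Continuous Φ := by fun_prop
  have hK : IsCompact (stdSimplex ℝ (Fin N) ×ˢ Set.univ.pi fun _ : Fin N ↦ s) :=
    (isCompact_stdSimplex ℝ (Fin N)).prod (isCompact_univ_pi fun _ ↦ hs)
  suffices h : convexHull ℝ s = Φ '' (stdSimplex ℝ (Fin N) ×ˢ Set.univ.pi fun _ ↦ s) from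
    h ▸ (hK.image hΦ).isClosed
  apply Set.Subset.antisymm
  · intro x hx
    obtain ⟨ι, _, z, w, hz, hind, hw, hw₁, rfl⟩ := eq_pos_convex_span_of_mem_convexHull hx
    have hcard : Fintype.card ι ≤ N :=
      hind.card_le_finrank_succ.trans (Nat.succ_le_succ (Submodule.finrank_le _))
    obtain ⟨w', z', hw', hz', hsum, hcomb⟩ := exists_fin_combination_of_card_le hne hcard
      (fun i ↦ (hw i).le) (fun i ↦ hz (Set.mem_range_self i))
    exact ⟨(w', z'), ⟨⟨hw', hsum.trans hw₁⟩, fun i _ ↦ hz' i⟩, hcomb⟩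
  · rintro _ ⟨⟨w, z⟩, ⟨⟨hw, hw₁⟩, hz⟩, rfl⟩
    exact (convex_convexHull ℝ s).sum_mem (fun i _ ↦ hw i) hw₁
      fun i _ ↦ subset_convexHull ℝ s (hz i (Set.mem_univ i))

section NuclearRank

variable {V : Type} [NormedAddCommGroup V] [NormedSpace ℝ V]

/-- A norm-attaining combination of extreme points with nonnegative weights bounds the nuclear
rank by its number of terms. -/
theorem nuclearRank_le_of_nonneg {r : ℕ} {x : V} {w : Fin r → ℝ} {z : Fin r → V}
    (hw : ∀ i, 0 ≤ w i)
    (hz : ∀ i, z i ∈ Set.extremePoints ℝ (Metric.closedBall (0 : V) 1))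
    (hx : x = ∑ i, w i • z i) (hnorm : ‖x‖ = ∑ i, w i) :
    nuclearRank x ≤ r := by
  classical
  let e := Fintype.equivFin {i // 0 < w i}
  have hcard : Fintype.card {i // 0 < w i} ≤ r := by
    simpa using Fintype.card_subtype_le fun i : Fin r ↦ 0 < w i
  refine le_trans (Nat.sInf_le ⟨fun j ↦ w (e.symm j), fun j ↦ z (e.symm j),
    fun j ↦ (e.symm j).2, fun j ↦ hz _, ?_, ?_⟩) hcard
  · rw [hx, e.symm.sum_comp fun i ↦ w i • z i]
    refine (Fintype.sum_of_injective Subtype.val Subtype.val_injective _ _ (fun i hi ↦ ?_)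
      fun _ ↦ rfl).symm
    have : w i = 0 := (hw i).antisymm' (not_lt.1 fun h ↦ hi ⟨⟨i, h⟩, rfl⟩)
    simp [this]
  · rw [hnorm, e.symm.sum_comp fun i ↦ w i]
    refine (Fintype.sum_of_injective Subtype.val Subtype.val_injective _ _ (fun i hi ↦ ?_)
      fun _ ↦ rfl).symm
    exact (hw i).antisymm' (not_lt.1 fun h ↦ hi ⟨⟨i, h⟩, rfl⟩)

variable [FiniteDimensional ℝ V]

/-- If the extreme points of the unit ball form a compact set, every vector has a nuclear
decomposition. -/
theorem exists_nuclear_decomposition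
    (hE : IsCompact (Set.extremePoints ℝ (Metric.closedBall (0 : V) 1))) (x : V) :
    ∃ (r : ℕ) (lam : Fin r → ℝ) (y : Fin r → V), (∀ i, 0 < lam i) ∧
      (∀ i, y i ∈ Set.extremePoints ℝ (Metric.closedBall (0 : V) 1)) ∧
      x = ∑ i, lam i • y i ∧ ‖x‖ = ∑ i, lam i := by
  rcases eq_or_ne x 0 with rfl | hx
  · exact ⟨0, Fin.elim0, Fin.elim0, by simp⟩
  have := FiniteDimensional.proper ℝ V
  have hx' : ‖x‖ ≠ 0 := norm_ne_zero_iff.2 hx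
  have hmem : ‖x‖⁻¹ • x ∈
      convexHull ℝ (Set.extremePoints ℝ (Metric.closedBall (0 : V) 1)) := by
    rw [← hE.isClosed_convexHull_of_finiteDimensional.closure_eq,
      closure_convexHull_extremePoints (isCompact_closedBall 0 1) (convex_closedBall 0 1)]
    simp [norm_smul, hx']
  obtain ⟨ι, _, z, w, hz, -, hw, hw₁, hsum⟩ := eq_pos_convex_span_of_mem_convexHull hmem
  let e := Fintype.equivFin ι
  refine ⟨Fintype.card ι, fun j ↦ ‖x‖ * w (e.symm j), fun j ↦ z (e.symm j),
    fun j ↦ mul_pos (norm_pos_iff.2 hx) (hw _), fun j ↦ hz (Set.mem_range_self _), ?_, ?_⟩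
  · rw [e.symm.sum_comp fun i ↦ (‖x‖ * w i) • z i]
    simp_rw [mul_smul]
    rw [← Finset.smul_sum, hsum, smul_inv_smul₀ hx']
  · rw [e.symm.sum_comp fun i ↦ ‖x‖ * w i, ← Finset.mul_sum, hw₁, mul_one]

theorem exists_nonneg_decomposition_of_nuclearRank_le
    (hE : IsCompact (Set.extremePoints ℝ (Metric.closedBall (0 : V) 1))) {r : ℕ} {x : V}
    (hr : nuclearRank x ≤ r) :
    ∃ (w : Fin r → ℝ) (z : Fin r → V), (∀ i, 0 ≤ w i) ∧
      (∀ i, z i ∈ Set.extremePoints ℝ (Metric.closedBall (0 : V) 1)) ∧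
      x = ∑ i, w i • z i ∧ ‖x‖ = ∑ i, w i := by
  have := FiniteDimensional.proper ℝ V
  obtain ⟨w, z, hw, hz, hx, hnorm⟩ := Nat.sInf_mem (exists_nuclear_decomposition hE x)
  have hne : (Set.extremePoints ℝ (Metric.closedBall (0 : V) 1)).Nonempty :=
    (isCompact_closedBall 0 1).extremePoints_nonempty (Metric.nonempty_closedBall.2 zero_le_one)
  obtain ⟨w', z', hw', hz', hsum, hcomb⟩ := exists_fin_combination_of_card_le hne
    ((Fintype.card_fin _).trans_le hr) (fun i ↦ (hw i).le) hz
  exact ⟨w', z', hw', hz', hx.trans hcomb.symm, hnorm.trans hsum.symm⟩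

end NuclearRank

/-- Proposition 4.4: if the set of extreme points of the closed unit ball is compact,
then the nuclear rank is upper semicontinuous: a limit of elements of nuclear rank at
most `r` has nuclear rank at most `r`. -/
theorem stmt7 {V : Type} [NormedAddCommGroup V] [NormedSpace ℝ V] [FiniteDimensional ℝ V]
    (hE : IsCompact (Set.extremePoints ℝ (Metric.closedBall (0 : V) 1)))
    (r : ℕ) (x : ℕ → V) (x₀ : V)
    (hconv : Filter.Tendsto x Filter.atTop (nhds x₀))
    (hr : ∀ m, nuclearRank (x m) ≤ r) :
    nuclearRank x₀ ≤ r := by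
  obtain ⟨C, hC⟩ := hconv.norm.bddAbove_range
  let E := Set.extremePoints ℝ (Metric.closedBall (0 : V) 1)
  let Φ : (Fin r → ℝ) × (Fin r → V) → V := fun p ↦ ∑ i, p.1 i • p.2 i
  have hΦ : Continuous Φ := by fun_prop
  let K : Set ((Fin r → ℝ) × (Fin r → V)) :=
    (Set.univ.pi (fun _ ↦ Set.Icc 0 C) ×ˢ Set.univ.pi fun _ ↦ E) ∩ {p | ‖Φ p‖ = ∑ i, p.1 i}
  have hK : IsCompact K :=
    ((isCompact_univ_pi fun _ ↦ isCompact_Icc).prod (isCompact_univ_pi fun _ ↦ hE)).inter_right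
      (isClosed_eq (by fun_prop) (by fun_prop))
  have hmem (m : ℕ) : x m ∈ Φ '' K := by
    obtain ⟨w, z, hw, hz, hx, hnorm⟩ := exists_nonneg_decomposition_of_nuclearRank_le hE (hr m)
    have hwC (i : Fin r) : w i ≤ C :=
      (Finset.single_le_sum (fun j _ ↦ hw j) (Finset.mem_univ i)).trans
        (hnorm ▸ hC (Set.mem_range_self m))
    exact ⟨(w, z), ⟨⟨fun i _ ↦ ⟨hw i, hwC i⟩, fun i _ ↦ hz i⟩,
      (congrArg norm hx).symm.trans hnorm⟩, hx.symm⟩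
  obtain ⟨⟨w, z⟩, ⟨⟨hw, hz⟩, hnorm⟩, rfl⟩ :=
    (hK.image hΦ).isClosed.mem_of_tendsto hconv (Filter.Eventually.of_forall hmem)
  exact nuclearRank_le_of_nonneg (fun i ↦ (hw i (Set.mem_univ i)).1)
    (fun i ↦ hz i (Set.mem_univ i)) rfl hnorm
end
end

section
/- Let e₁, e₂ be the standard basis vectors of ℝ² and define B = (1/2)(e₁⊗e₁⊗e₂ + e₁⊗e₂⊗e₁ + e₂⊗e₁⊗e₁ − e₂⊗e₂⊗e₂) ∈ ℝ^{2×2×2} ⊆ ℂ^{2×2×2}. Then ‖B‖_{σ,ℝ} = 1/2, ‖B‖_{σ,ℂ} = 1/√2, ‖B‖_{*,ℝ} = 2, and ‖B‖_{*,ℂ} = √2. In particular the real and complex spectral norms of B differ, as do its real and complex nuclear norms. -/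
open scoped BigOperators

noncomputable section

variable {𝕜 : Type} [RCLike 𝕜]

/-- The standard basis vectors `e₁, e₂` of `ℝ²`. -/
def stdBasis (j : Fin 2) : EuclideanSpace ℝ (Fin 2) := EuclideanSpace.single j 1

/-- The tensor `B = (1/2)(e₁⊗e₁⊗e₂ + e₁⊗e₂⊗e₁ + e₂⊗e₁⊗e₁ − e₂⊗e₂⊗e₂) ∈ ℝ^{2×2×2}`. -/
def tenB : (Fin 3 → Fin 2) → ℝ :=
  (1/2 : ℝ) • (rankOne ![stdBasis 0, stdBasis 0, stdBasis 1]
    + rankOne ![stdBasis 0, stdBasis 1, stdBasis 0]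
    + rankOne ![stdBasis 1, stdBasis 0, stdBasis 0]
    - rankOne ![stdBasis 1, stdBasis 1, stdBasis 1])

theorem sum_fin_three_fin_two {M : Type} [AddCommMonoid M] (f : (Fin 3 → Fin 2) → M) :
    ∑ i, f i = ∑ a, ∑ b, ∑ c, f ![a, b, c] := by
  rw [← Fintype.sum_prod_type', ← Fintype.sum_prod_type']
  refine (Fintype.sum_equiv (⟨fun p => ![p.1.1, p.1.2, p.2], fun g => ((g 0, g 1), g 2),
    fun _ => rfl, fun g => ?_⟩ : (Fin 2 × Fin 2) × Fin 2 ≃ (Fin 3 → Fin 2)) _ _ fun _ => rfl).symm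
  ext k
  fin_cases k <;> rfl

theorem specNorm_eq_of_bound {ι : Type} [Fintype ι] [DecidableEq ι] {n : ι → ℕ}
    {A : ((k : ι) → Fin (n k)) → 𝕜} {M : ℝ}
    (hM : ∀ x, ‖tInner A (rankOne x)‖ ≤ M * ∏ k, ‖x k‖)
    (hA : ∃ x : (k : ι) → EuclideanSpace 𝕜 (Fin (n k)),
      (∀ k, ‖x k‖ = 1) ∧ M = ‖tInner A (rankOne x)‖) :
    specNorm A = M := by
  refine IsGreatest.csSup_eq ⟨hA, ?_⟩
  rintro r ⟨x, hx, rfl⟩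
  simpa [hx] using hM x

theorem tInner_sum_right_s12 {ι κ : Type} [Fintype ι] [DecidableEq ι] [Fintype κ] {n : ι → ℕ}
    (A : ((k : ι) → Fin (n k)) → 𝕜) (T : κ → ((k : ι) → Fin (n k)) → 𝕜) :
    tInner A (∑ j, T j) = ∑ j, tInner A (T j) := by
  simp only [tInner, Finset.sum_apply, map_sum, Finset.mul_sum]
  exact Finset.sum_comm

theorem nucNorm_eq_of_bound {ι : Type} [Fintype ι] [DecidableEq ι] {n : ι → ℕ}
    {A : ((k : ι) → Fin (n k)) → 𝕜} {M N : ℝ} (hpos : 0 < M)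
    (hM : ∀ x, ‖tInner A (rankOne x)‖ ≤ M * ∏ k, ‖x k‖)
    (hMN : M * N = ‖tInner A A‖)
    (hA : ∃ (r : ℕ) (x : Fin r → (k : ι) → EuclideanSpace 𝕜 (Fin (n k))),
      A = (∑ i, rankOne (x i)) ∧ N = ∑ i, ∏ k, ‖x i k‖) :
    nucNorm A = N := by
  refine IsLeast.csInf_eq ⟨hA, ?_⟩
  rintro s ⟨r, x, hx, rfl⟩
  refine le_of_mul_le_mul_left ?_ hpos
  calc M * N = ‖tInner A (∑ i, rankOne (x i))‖ := by rw [hMN, ← hx]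
    _ ≤ ∑ i, ‖tInner A (rankOne (x i))‖ := by rw [tInner_sum_right_s12]; exact norm_sum_le _ _
    _ ≤ ∑ i, M * ∏ k, ‖x i k‖ := Finset.sum_le_sum fun i _ => hM (x i)
    _ = M * ∑ i, ∏ k, ‖x i k‖ := by rw [Finset.mul_sum]

theorem rankOne_vec_three_apply (x y z : EuclideanSpace 𝕜 (Fin 2)) (a b c : Fin 2) :
    rankOne (n := fun _ : Fin 3 => 2) ![x, y, z] ![a, b, c] = x a * y b * z c :=
  Fin.prod_univ_three _

theorem prod_norm_vec_three {E : Type} [Norm E] (x y z : E) :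
    ∏ k, ‖(![x, y, z] : Fin 3 → E) k‖ = ‖x‖ * ‖y‖ * ‖z‖ :=
  Fin.prod_univ_three _

theorem tenB_apply (a b c : Fin 2) :
    tenB ![a, b, c] = !![!![0, 1/2; 1/2, 0] b c, !![1/2, 0; 0, -1/2] b c] 0 a := by
  simp only [tenB, Pi.smul_apply, Pi.add_apply, Pi.sub_apply, rankOne_vec_three_apply]
  fin_cases a <;> fin_cases b <;> fin_cases c <;> norm_num [stdBasis]

theorem tInner_tenB_rankOne (x : Fin 3 → EuclideanSpace ℝ (Fin 2)) :
    tInner tenB (rankOne x) = 1/2 * (x 0 0 * x 1 0 * x 2 1 + x 0 0 * x 1 1 * x 2 0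
      + x 0 1 * x 1 0 * x 2 0 - x 0 1 * x 1 1 * x 2 1) := by
  rw [tInner, sum_fin_three_fin_two]
  simp [tenB_apply, rankOne, Fin.prod_univ_three]
  ring

theorem tInner_tenB_complex_rankOne (x : Fin 3 → EuclideanSpace ℂ (Fin 2)) :
    tInner (fun i => (tenB i : ℂ)) (rankOne x) = (starRingEnd ℂ)
      (1/2 * (x 0 0 * x 1 0 * x 2 1 + x 0 0 * x 1 1 * x 2 0
      + x 0 1 * x 1 0 * x 2 0 - x 0 1 * x 1 1 * x 2 1)) := by
  rw [tInner, sum_fin_three_fin_two]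
  simp [Complex.conj_ofNat, tenB_apply, rankOne, Fin.prod_univ_three]
  ring

theorem tInner_tenB_self : tInner tenB tenB = 1 := by
  rw [tInner, sum_fin_three_fin_two]
  norm_num [tenB_apply]

theorem tInner_tenB_complex_self :
    tInner (fun i => (tenB i : ℂ)) (fun i => (tenB i : ℂ)) = 1 := by
  rw [tInner, sum_fin_three_fin_two]
  norm_num [tenB_apply]

theorem norm_tInner_tenB_rankOne_le (x : Fin 3 → EuclideanSpace ℝ (Fin 2)) :
    ‖tInner tenB (rankOne x)‖ ≤ 1/2 * ∏ k, ‖x k‖ := by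
  rw [Real.norm_eq_abs]
  refine abs_le_of_sq_le_sq ?_ (by positivity)
  have h (k) : ‖x k‖ ^ 2 = x k 0 ^ 2 + x k 1 ^ 2 := by
    simp [EuclideanSpace.norm_sq_eq]
  rw [tInner_tenB_rankOne, Fin.prod_univ_three, mul_pow, mul_pow, mul_pow, mul_pow, h 0, h 1,
    h 2]
  linarith [sq_nonneg (x 0 0 * x 1 0 * x 2 0 - x 0 0 * x 1 1 * x 2 1
    - x 0 1 * x 1 0 * x 2 1 - x 0 1 * x 1 1 * x 2 0)]

theorem add_mul_le_of_sq_add_sq {p₁ q₁ p₂ q₂ p₃ q₃ a b c : ℝ} (ha : 0 ≤ a) (hb : 0 ≤ b)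
    (hc : 0 ≤ c) (hp₁ : 0 ≤ p₁) (hq₁ : 0 ≤ q₁) (hp₂ : 0 ≤ p₂) (hq₂ : 0 ≤ q₂)
    (h₁ : p₁ ^ 2 + q₁ ^ 2 = 2 * a ^ 2) (h₂ : p₂ ^ 2 + q₂ ^ 2 = 2 * b ^ 2)
    (h₃ : p₃ ^ 2 + q₃ ^ 2 = 2 * c ^ 2) :
    p₁ * p₂ * p₃ + q₁ * q₂ * q₃ ≤ 2 * √2 * (a * b * c) := by
  have hs : (√2 * c) ^ 2 = 2 * c ^ 2 := by rw [mul_pow, Real.sq_sqrt (by norm_num)]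
  have hp : p₃ ≤ √2 * c := le_of_sq_le_sq (by nlinarith [sq_nonneg q₃]) (by positivity)
  have hq : q₃ ≤ √2 * c := le_of_sq_le_sq (by nlinarith [sq_nonneg p₃]) (by positivity)
  have hab : p₁ * p₂ + q₁ * q₂ ≤ 2 * (a * b) := by
    refine le_of_sq_le_sq ?_ (by positivity)
    have : (2 * (a * b)) ^ 2 = (p₁ ^ 2 + q₁ ^ 2) * (p₂ ^ 2 + q₂ ^ 2) := by rw [h₁, h₂]; ring
    rw [this]
    linarith [sq_nonneg (p₁ * q₂ - q₁ * p₂)]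
  calc p₁ * p₂ * p₃ + q₁ * q₂ * q₃ ≤ p₁ * p₂ * (√2 * c) + q₁ * q₂ * (√2 * c) := by gcongr
    _ = (p₁ * p₂ + q₁ * q₂) * (√2 * c) := by ring
    _ ≤ 2 * (a * b) * (√2 * c) := by gcongr
    _ = 2 * √2 * (a * b * c) := by ring

theorem norm_tInner_tenB_complex_rankOne_le (x : Fin 3 → EuclideanSpace ℂ (Fin 2)) :
    ‖tInner (fun i => (tenB i : ℂ)) (rankOne x)‖ ≤ 1 / √2 * ∏ k, ‖x k‖ := by
  have h (k) : ‖x k 0 + Complex.I * x k 1‖ ^ 2 + ‖x k 0 - Complex.I * x k 1‖ ^ 2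
      = 2 * ‖x k‖ ^ 2 := by
    have := parallelogram_law_with_norm ℝ (x k 0) (Complex.I * x k 1)
    rw [norm_mul, Complex.norm_I, one_mul] at this
    rw [EuclideanSpace.norm_sq_eq, Fin.sum_univ_two]
    linarith
  have key := add_mul_le_of_sq_add_sq (norm_nonneg _) (norm_nonneg _) (norm_nonneg _)
    (norm_nonneg _) (norm_nonneg _) (norm_nonneg _) (norm_nonneg _) (h 0) (h 1) (h 2)
  have hform : (1/2 * (x 0 0 * x 1 0 * x 2 1 + x 0 0 * x 1 1 * x 2 0
      + x 0 1 * x 1 0 * x 2 0 - x 0 1 * x 1 1 * x 2 1)) = -Complex.I / 4 *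
      ((x 0 0 + Complex.I * x 0 1) * (x 1 0 + Complex.I * x 1 1) * (x 2 0 + Complex.I * x 2 1)
      - (x 0 0 - Complex.I * x 0 1) * (x 1 0 - Complex.I * x 1 1)
        * (x 2 0 - Complex.I * x 2 1)) := by
    have hI : Complex.I ^ 2 = -1 := Complex.I_sq
    have hI4 : Complex.I ^ 4 = 1 := Complex.I_pow_four
    ring_nf
    rw [hI, hI4]
    ring
  rw [tInner_tenB_complex_rankOne, RCLike.norm_conj, hform, norm_mul, Fin.prod_univ_three]
  have hs : 1 / √2 = 1 / 4 * (2 * √2) := by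
    have : √2 ^ 2 = 2 := Real.sq_sqrt (by norm_num)
    field_simp
    linarith
  have hn : ‖-Complex.I / 4‖ = 1 / 4 := by simp
  rw [hn, hs, mul_assoc (1 / 4)]
  refine mul_le_mul_of_nonneg_left ((norm_sub_le _ _).trans ?_) (by norm_num)
  simpa only [norm_mul] using key

theorem norm_toLp_one_I : ‖(!₂[1, Complex.I] : EuclideanSpace ℂ (Fin 2))‖ = √2 := by
  rw [EuclideanSpace.norm_eq]
  norm_num

theorem norm_toLp_one_neg_I : ‖(!₂[1, -Complex.I] : EuclideanSpace ℂ (Fin 2))‖ = √2 := by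
  rw [EuclideanSpace.norm_eq]
  norm_num

theorem specNorm_tenB : specNorm tenB = 1/2 := by
  refine specNorm_eq_of_bound norm_tInner_tenB_rankOne_le
    ⟨![stdBasis 0, stdBasis 0, stdBasis 1], fun k => ?_, ?_⟩
  · fin_cases k <;> simp [stdBasis]
  · rw [tInner_tenB_rankOne]
    change (1 : ℝ) / 2 = ‖(1 / 2 : ℝ) * (stdBasis 0 0 * stdBasis 0 0 * stdBasis 1 1
      + stdBasis 0 0 * stdBasis 0 1 * stdBasis 1 0 + stdBasis 0 1 * stdBasis 0 0 * stdBasis 1 0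
      - stdBasis 0 1 * stdBasis 0 1 * stdBasis 1 1)‖
    norm_num [stdBasis]

theorem specNorm_tenB_complex : specNorm (fun i => (tenB i : ℂ)) = 1 / √2 := by
  refine specNorm_eq_of_bound norm_tInner_tenB_complex_rankOne_le
    ⟨fun _ => ((√2 : ℝ) : ℂ)⁻¹ • !₂[1, Complex.I], fun k => ?_, ?_⟩
  · rw [norm_smul, norm_toLp_one_I, norm_inv, Complex.norm_of_nonneg (by positivity)]
    exact inv_mul_cancel₀ (by positivity)
  · rw [tInner_tenB_complex_rankOne, RCLike.norm_conj]
    have h : (1/2 : ℂ) * (((√2 : ℝ) : ℂ)⁻¹ ^ 3 * 4 * Complex.I)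
        = ((1 / √2 : ℝ) : ℂ) * Complex.I := by
      have : ((√2 : ℝ) : ℂ) ^ 2 = 2 := by
        rw [← Complex.ofReal_pow, Real.sq_sqrt (by norm_num)]; norm_num
      have h0 : ((√2 : ℝ) : ℂ) ≠ 0 := by simp
      push_cast
      field_simp
      rw [this]
      norm_num
    have h' : ‖((1 / √2 : ℝ) : ℂ) * Complex.I‖ = 1 / √2 := by
      rw [norm_mul, Complex.norm_I, mul_one, Complex.norm_of_nonneg (by positivity)]
    rw [← h', ← h]
    congr 2
    have hI : Complex.I ^ 3 = -Complex.I := Complex.I_pow_three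
    simp
    ring_nf
    rw [hI]
    ring

theorem nucNorm_tenB : nucNorm tenB = 2 := by
  refine nucNorm_eq_of_bound (by norm_num) norm_tInner_tenB_rankOne_le ?_
    ⟨4, ![![(1/2 : ℝ) • stdBasis 0, stdBasis 0, stdBasis 1],
      ![(1/2 : ℝ) • stdBasis 0, stdBasis 1, stdBasis 0],
      ![(1/2 : ℝ) • stdBasis 1, stdBasis 0, stdBasis 0],
      ![(-1/2 : ℝ) • stdBasis 1, stdBasis 1, stdBasis 1]], ?_, ?_⟩
  · rw [tInner_tenB_self]; norm_num
  · ext i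
    simp [tenB, rankOne, Fin.sum_univ_four, Fin.prod_univ_three]
    ring
  · rw [Fin.sum_univ_four]
    simp only [Matrix.cons_val]
    simp only [prod_norm_vec_three, norm_smul]
    norm_num [stdBasis]

theorem nucNorm_tenB_complex : nucNorm (fun i => (tenB i : ℂ)) = √2 := by
  refine nucNorm_eq_of_bound (by positivity) norm_tInner_tenB_complex_rankOne_le ?_
    ⟨2, ![![(-Complex.I / 4) • !₂[1, Complex.I], !₂[1, Complex.I], !₂[1, Complex.I]],
      ![(Complex.I / 4) • !₂[1, -Complex.I], !₂[1, -Complex.I], !₂[1, -Complex.I]]], ?_, ?_⟩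
  · rw [tInner_tenB_complex_self]; simp
  · ext i
    obtain ⟨a, b, c, rfl⟩ : ∃ a b c, i = ![a, b, c] :=
      ⟨i 0, i 1, i 2, by ext k; fin_cases k <;> rfl⟩
    rw [tenB_apply, Fin.sum_univ_two, Pi.add_apply, rankOne, rankOne, Fin.prod_univ_three,
      Fin.prod_univ_three]
    have hI : Complex.I * Complex.I = -1 := Complex.I_mul_I
    fin_cases a <;> fin_cases b <;> fin_cases c <;> simp <;> grind
  · rw [Fin.sum_univ_two, Fin.prod_univ_three, Fin.prod_univ_three]
    have h : √2 ^ 2 = 2 := Real.sq_sqrt (by norm_num)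
    have h1 : ‖-Complex.I / 4‖ = 1 / 4 := by simp
    have h2 : ‖Complex.I / 4‖ = 1 / 4 := by simp
    simp only [Matrix.cons_val, norm_smul, norm_toLp_one_I, norm_toLp_one_neg_I, h1, h2]
    linear_combination (-√2 / 2) * h

/-- Lemma 6.1: the real and complex spectral and nuclear norms of `B`; in particular
`‖B‖_{σ,ℝ} ≠ ‖B‖_{σ,ℂ}` and `‖B‖_{*,ℝ} ≠ ‖B‖_{*,ℂ}`. -/
theorem stmt12 :
    specNorm tenB = 1/2 ∧
    specNorm (fun i => (tenB i : ℂ)) = 1 / Real.sqrt 2 ∧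
    nucNorm tenB = 2 ∧
    nucNorm (fun i => (tenB i : ℂ)) = Real.sqrt 2 ∧
    specNorm tenB ≠ specNorm (fun i => (tenB i : ℂ)) ∧
    nucNorm tenB ≠ nucNorm (fun i => (tenB i : ℂ)) := by
  have h2 : (√2) ^ 2 = 2 := Real.sq_sqrt (by norm_num)
  have hlt : 1 < √2 ∧ √2 < 2 :=
    ⟨by nlinarith [Real.sqrt_nonneg 2], by nlinarith [Real.sqrt_nonneg 2]⟩
  refine ⟨specNorm_tenB, specNorm_tenB_complex, nucNorm_tenB, nucNorm_tenB_complex, ?_, ?_⟩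
  · rw [specNorm_tenB, specNorm_tenB_complex]
    exact (one_div_lt_one_div_of_lt (by linarith) hlt.2).ne
  · rw [nucNorm_tenB, nucNorm_tenB_complex]
    exact hlt.2.ne'
end
end

section
/- Let A ∈ ℝ^{m×n×p} be a 3-tensor with multilinear rank (r₁, r₂, r₃), and let ♭₁(A) ∈ ℝ^{m×np}, ♭₂(A) ∈ ℝ^{n×mp}, ♭₃(A) ∈ ℝ^{p×mn} be its three flattenings. Then max{ ‖♭₁(A)‖_σ/√min(r₂,r₃), ‖♭₂(A)‖_σ/√min(r₁,r₃), ‖♭₃(A)‖_σ/√min(r₁,r₂) } ≤ ‖A‖_σ ≤ min{ ‖♭₁(A)‖_σ, ‖♭₂(A)‖_σ, ‖♭₃(A)‖_σ }, and max{ ‖♭₁(A)‖_*, ‖♭₂(A)‖_*, ‖♭₃(A)‖_* } ≤ ‖A‖_* ≤ min{ √min(r₂,r₃)·‖♭₁(A)‖_*, √min(r₁,r₃)·‖♭₂(A)‖_*, √min(r₁,r₂)·‖♭₃(A)‖_* }, where ‖·‖_σ and ‖·‖_* applied to a matrix denote its usual (l²) spectral and nuclear norms. -/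
open scoped BigOperators

noncomputable section

/-- The spectral norm of a 3-tensor `A ∈ ℝ^{m×n×p}`. -/
def tSpec {m n p : ℕ} (A : Fin m → Fin n → Fin p → ℝ) : ℝ :=
  sSup { r : ℝ | ∃ (x : EuclideanSpace ℝ (Fin m)) (y : EuclideanSpace ℝ (Fin n))
      (z : EuclideanSpace ℝ (Fin p)),
    ‖x‖ = 1 ∧ ‖y‖ = 1 ∧ ‖z‖ = 1 ∧ r = |∑ i, ∑ j, ∑ k, A i j k * x i * y j * z k| }

/-- The nuclear norm of a 3-tensor `A ∈ ℝ^{m×n×p}`. -/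
def tNuc {m n p : ℕ} (A : Fin m → Fin n → Fin p → ℝ) : ℝ :=
  sInf { s : ℝ | ∃ (r : ℕ) (x : Fin r → EuclideanSpace ℝ (Fin m))
      (y : Fin r → EuclideanSpace ℝ (Fin n)) (z : Fin r → EuclideanSpace ℝ (Fin p)),
    (∀ i j k, A i j k = ∑ t, x t i * y t j * z t k) ∧
    s = ∑ t, ‖x t‖ * ‖y t‖ * ‖z t‖ }

/-- The (l²) spectral norm of a matrix, i.e. its largest singular value. -/
def mSpec {α β : Type} [Fintype α] [Fintype β] (M : Matrix α β ℝ) : ℝ :=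
  sSup { r : ℝ | ∃ (x : EuclideanSpace ℝ α) (y : EuclideanSpace ℝ β),
    ‖x‖ = 1 ∧ ‖y‖ = 1 ∧ r = |∑ a, ∑ b, M a b * x a * y b| }

/-- The (l²) nuclear norm of a matrix, i.e. the sum of its singular values. -/
def mNuc {α β : Type} [Fintype α] [Fintype β] (M : Matrix α β ℝ) : ℝ :=
  sInf { s : ℝ | ∃ (r : ℕ) (x : Fin r → EuclideanSpace ℝ α) (y : Fin r → EuclideanSpace ℝ β),
    (∀ a b, M a b = ∑ i, x i a * y i b) ∧ s = ∑ i, ‖x i‖ * ‖y i‖ }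

/-- The flattening of a 3-tensor along the first index. -/
def fl1 {m n p : ℕ} (A : Fin m → Fin n → Fin p → ℝ) : Matrix (Fin m) (Fin n × Fin p) ℝ :=
  Matrix.of fun i jk => A i jk.1 jk.2

/-- The flattening of a 3-tensor along the second index. -/
def fl2 {m n p : ℕ} (A : Fin m → Fin n → Fin p → ℝ) : Matrix (Fin n) (Fin m × Fin p) ℝ :=
  Matrix.of fun j ik => A ik.1 j ik.2

/-- The flattening of a 3-tensor along the third index. -/
def fl3 {m n p : ℕ} (A : Fin m → Fin n → Fin p → ℝ) : Matrix (Fin p) (Fin m × Fin n) ℝ :=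
  Matrix.of fun k ij => A ij.1 ij.2 k

/-- An orthonormal basis of the column space of a matrix reproduces the matrix. -/
theorem exists_orthonormal_rank {α β : Type} [Fintype α] [Fintype β] (M : Matrix α β ℝ) :
    ∃ q : Fin M.rank → EuclideanSpace ℝ α, Orthonormal ℝ q ∧
      ∀ a b, M a b = ∑ l, q l a * ∑ a', M a' b * q l a' := by
  classical
  let e : (α → ℝ) ≃ₗ[ℝ] EuclideanSpace ℝ α := (WithLp.linearEquiv 2 ℝ (α → ℝ)).symm
  let S : Submodule ℝ (EuclideanSpace ℝ α) :=
    (Submodule.span ℝ (Set.range M.col)).map (e : (α → ℝ) →ₗ[ℝ] EuclideanSpace ℝ α)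
  have hS : Module.finrank ℝ S = M.rank := by
    rw [Matrix.rank_eq_finrank_span_cols]
    exact LinearEquiv.finrank_map_eq e _
  let b : OrthonormalBasis (Fin M.rank) ℝ S := (stdOrthonormalBasis ℝ S).reindex (finCongr hS)
  refine ⟨fun l => (b l : EuclideanSpace ℝ α), ?_, ?_⟩
  · exact b.orthonormal.comp_linearIsometry S.subtypeₗᵢ
  · intro a c
    have hc : e (M.col c) ∈ S :=
      Submodule.mem_map_of_mem (Submodule.subset_span ⟨c, rfl⟩)
    have h := congrArg (fun v : S => (v : EuclideanSpace ℝ α) a) (b.sum_repr' ⟨e (M.col c), hc⟩)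
    simp only [Submodule.coe_sum, Submodule.coe_smul, Submodule.coe_inner] at h
    have h2 : (e (M.col c)) a = M a c := rfl
    rw [h2] at h
    rw [← h]
    simp only [PiLp.inner_apply, WithLp.ofLp_sum, WithLp.ofLp_smul, Finset.sum_apply,
      Pi.smul_apply, smul_eq_mul]
    refine Finset.sum_congr rfl fun l _ => ?_
    rw [mul_comm]
    rfl

theorem abs_apply_le_norm {α : Type} [Fintype α] (x : EuclideanSpace ℝ α) (a : α) :
    |x a| ≤ ‖x‖ := by
  simpa using PiLp.norm_apply_le x a

theorem abs_tensor_le {m n p : ℕ} (A : Fin m → Fin n → Fin p → ℝ)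
    (x : EuclideanSpace ℝ (Fin m)) (y : EuclideanSpace ℝ (Fin n)) (z : EuclideanSpace ℝ (Fin p)) :
    |∑ i, ∑ j, ∑ k, A i j k * x i * y j * z k| ≤ tSpec A * ‖x‖ * ‖y‖ * ‖z‖ := by
  have hb : BddAbove { r : ℝ | ∃ (x : EuclideanSpace ℝ (Fin m)) (y : EuclideanSpace ℝ (Fin n))
      (z : EuclideanSpace ℝ (Fin p)),
      ‖x‖ = 1 ∧ ‖y‖ = 1 ∧ ‖z‖ = 1 ∧ r = |∑ i, ∑ j, ∑ k, A i j k * x i * y j * z k| } := by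
    refine ⟨∑ i, ∑ j, ∑ k, |A i j k|, ?_⟩
    rintro _ ⟨x, y, z, hx, hy, hz, rfl⟩
    refine (Finset.abs_sum_le_sum_abs _ _).trans (Finset.sum_le_sum fun i _ => ?_)
    refine (Finset.abs_sum_le_sum_abs _ _).trans (Finset.sum_le_sum fun j _ => ?_)
    refine (Finset.abs_sum_le_sum_abs _ _).trans (Finset.sum_le_sum fun k _ => ?_)
    have h1 := (abs_apply_le_norm x i).trans hx.le
    have h2 := (abs_apply_le_norm y j).trans hy.le
    have h3 := (abs_apply_le_norm z k).trans hz.le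
    calc |A i j k * x i * y j * z k| = |A i j k| * |x i| * |y j| * |z k| := by
          simp only [abs_mul]
      _ ≤ |A i j k| * 1 * 1 * 1 := by gcongr
      _ = |A i j k| := by ring
  rcases eq_or_ne x 0 with rfl | hx
  · simp
  rcases eq_or_ne y 0 with rfl | hy
  · simp
  rcases eq_or_ne z 0 with rfl | hz
  · simp
  have hx' := norm_pos_iff.mpr hx
  have hy' := norm_pos_iff.mpr hy
  have hz' := norm_pos_iff.mpr hz
  have h := le_csSup hb ⟨‖x‖⁻¹ • x, ‖y‖⁻¹ • y, ‖z‖⁻¹ • z, norm_smul_inv_norm hx,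
    norm_smul_inv_norm hy, norm_smul_inv_norm hz, rfl⟩
  have hs : ∑ i, ∑ j, ∑ k, A i j k * (‖x‖⁻¹ • x) i * (‖y‖⁻¹ • y) j * (‖z‖⁻¹ • z) k =
      (∑ i, ∑ j, ∑ k, A i j k * x i * y j * z k) / (‖x‖ * ‖y‖ * ‖z‖) := by
    simp only [Finset.sum_div, PiLp.smul_apply, smul_eq_mul]
    refine Finset.sum_congr rfl fun i _ => Finset.sum_congr rfl fun j _ =>
      Finset.sum_congr rfl fun k _ => ?_
    field_simp
  rw [hs, abs_div, abs_of_pos (show 0 < ‖x‖ * ‖y‖ * ‖z‖ by positivity),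
    div_le_iff₀ (by positivity)] at h
  calc _ ≤ _ := h
    _ = _ := by rw [← mul_assoc, ← mul_assoc]; rfl

theorem abs_matrix_le_mSpec {α β : Type} [Fintype α] [Fintype β] (M : Matrix α β ℝ)
    (x : EuclideanSpace ℝ α) (y : EuclideanSpace ℝ β) (hx : ‖x‖ = 1) (hy : ‖y‖ = 1) :
    |∑ a, ∑ b, M a b * x a * y b| ≤ mSpec M := by
  refine le_csSup ⟨∑ a, ∑ b, |M a b|, ?_⟩ ⟨x, y, hx, hy, rfl⟩
  rintro _ ⟨x, y, hx, hy, rfl⟩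
  refine (Finset.abs_sum_le_sum_abs _ _).trans (Finset.sum_le_sum fun i _ => ?_)
  refine (Finset.abs_sum_le_sum_abs _ _).trans (Finset.sum_le_sum fun j _ => ?_)
  have h1 := (abs_apply_le_norm x i).trans hx.le
  have h2 := (abs_apply_le_norm y j).trans hy.le
  calc |M i j * x i * y j| = |M i j| * |x i| * |y j| := by simp only [abs_mul]
    _ ≤ |M i j| * 1 * 1 := by gcongr
    _ = |M i j| := by ring

theorem tSpec_nonneg {m n p : ℕ} (A : Fin m → Fin n → Fin p → ℝ) : 0 ≤ tSpec A := by
  refine Real.sSup_nonneg ?_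
  rintro _ ⟨x, y, z, -, -, -, rfl⟩
  exact abs_nonneg _

theorem mSpec_nonneg {α β : Type} [Fintype α] [Fintype β] (M : Matrix α β ℝ) : 0 ≤ mSpec M := by
  refine Real.sSup_nonneg ?_
  rintro _ ⟨x, y, -, -, rfl⟩
  exact abs_nonneg _

/-- Any finite decomposition into rank-one tensors bounds the nuclear norm. -/
theorem tNuc_le_sum {m n p : ℕ} {ι : Type} [Fintype ι] (A : Fin m → Fin n → Fin p → ℝ)
    (x : ι → EuclideanSpace ℝ (Fin m)) (y : ι → EuclideanSpace ℝ (Fin n))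
    (z : ι → EuclideanSpace ℝ (Fin p))
    (h : ∀ i j k, A i j k = ∑ t, x t i * y t j * z t k) :
    tNuc A ≤ ∑ t, ‖x t‖ * ‖y t‖ * ‖z t‖ := by
  refine csInf_le ⟨0, ?_⟩ ?_
  · rintro _ ⟨r, x, y, z, -, rfl⟩
    positivity
  · let e := Fintype.equivFin ι
    refine ⟨Fintype.card ι, x ∘ e.symm, y ∘ e.symm, z ∘ e.symm, fun i j k => ?_, ?_⟩
    · rw [h, ← e.symm.sum_comp]; rfl
    · rw [← e.symm.sum_comp]; rfl

theorem exists_tensor_decomposition {m n p : ℕ} (A : Fin m → Fin n → Fin p → ℝ) :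
    ∃ (r : ℕ) (x : Fin r → EuclideanSpace ℝ (Fin m))
      (y : Fin r → EuclideanSpace ℝ (Fin n)) (z : Fin r → EuclideanSpace ℝ (Fin p)),
      ∀ i j k, A i j k = ∑ t, x t i * y t j * z t k := by
  let e := Fintype.equivFin (Fin m × Fin n × Fin p)
  refine ⟨_, fun t => EuclideanSpace.single (e.symm t).1 (A (e.symm t).1 (e.symm t).2.1
    (e.symm t).2.2), fun t => EuclideanSpace.single (e.symm t).2.1 1,
    fun t => EuclideanSpace.single (e.symm t).2.2 1, fun i j k => ?_⟩
  rw [e.symm.sum_comp (fun s : Fin m × Fin n × Fin p =>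
    (EuclideanSpace.single s.1 (A s.1 s.2.1 s.2.2)) i *
      (EuclideanSpace.single s.2.1 (1 : ℝ)) j * (EuclideanSpace.single s.2.2 (1 : ℝ)) k)]
  simp [Fintype.sum_prod_type]

theorem mNuc_nonempty {m n p : ℕ} (A : Fin m → Fin n → Fin p → ℝ) :
    ∃ (r : ℕ) (x : Fin r → EuclideanSpace ℝ (Fin m))
      (y : Fin r → EuclideanSpace ℝ (Fin n × Fin p)),
      ∀ a b, fl1 A a b = ∑ t, x t a * y t b := by
  obtain ⟨r, x, y, z, h⟩ := exists_tensor_decomposition A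
  refine ⟨r, x, fun t => WithLp.toLp 2 fun b => y t b.1 * z t b.2, fun a b => ?_⟩
  simpa [fl1, mul_assoc] using h a b.1 b.2

theorem norm_outer {n p : ℕ} (y : EuclideanSpace ℝ (Fin n)) (z : EuclideanSpace ℝ (Fin p)) :
    ‖(WithLp.toLp 2 fun b : Fin n × Fin p => y b.1 * z b.2 :
      EuclideanSpace ℝ (Fin n × Fin p))‖ = ‖y‖ * ‖z‖ := by
  rw [EuclideanSpace.norm_eq, EuclideanSpace.norm_eq, EuclideanSpace.norm_eq,
    ← Real.sqrt_mul (by positivity), Finset.sum_mul_sum, Fintype.sum_prod_type]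
  simp [mul_pow]

theorem tSpec_le_mSpec_fl1 {m n p : ℕ} (A : Fin m → Fin n → Fin p → ℝ) :
    tSpec A ≤ mSpec (fl1 A) := by
  refine Real.sSup_le ?_ (mSpec_nonneg _)
  rintro _ ⟨x, y, z, hx, hy, hz, rfl⟩
  refine le_trans (le_of_eq ?_) (abs_matrix_le_mSpec (fl1 A) x
    (WithLp.toLp 2 fun b : Fin n × Fin p => y b.1 * z b.2) hx (by rw [norm_outer, hy, hz, one_mul]))
  simp [fl1, Fintype.sum_prod_type, mul_assoc]

theorem mNuc_fl1_le_tNuc {m n p : ℕ} (A : Fin m → Fin n → Fin p → ℝ) :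
    mNuc (fl1 A) ≤ tNuc A := by
  obtain ⟨r, x, y, z, h⟩ := exists_tensor_decomposition A
  refine le_csInf ⟨_, r, x, y, z, h, rfl⟩ ?_
  rintro _ ⟨r, x, y, z, h, rfl⟩
  refine csInf_le ⟨0, ?_⟩
    ⟨r, x, fun t => WithLp.toLp 2 fun b => y t b.1 * z t b.2, fun a b => ?_, ?_⟩
  · rintro _ ⟨r, x, y, -, rfl⟩
    positivity
  · simpa [fl1, mul_assoc] using h a b.1 b.2
  · simp only [norm_outer, mul_assoc]

/-- Contraction of a matrix, viewed as a two-variable function, against a vector. -/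
def contract {n p : ℕ} (W : Fin n → Fin p → ℝ) (q : EuclideanSpace ℝ (Fin n)) :
    EuclideanSpace ℝ (Fin p) :=
  WithLp.toLp 2 fun k => ∑ j, W j k * q j

theorem sum_norm_contract_le {n p r : ℕ} (W : Fin n → Fin p → ℝ)
    (q : Fin r → EuclideanSpace ℝ (Fin n)) (hq : Orthonormal ℝ q) :
    ∑ l, ‖contract W (q l)‖ ≤ √r * √(∑ j, ∑ k, W j k ^ 2) := by
  rw [← Real.sqrt_mul (by positivity)]
  refine Real.le_sqrt_of_sq_le ?_
  have hcs := sq_sum_le_card_mul_sum_sq (s := Finset.univ) (f := fun l => ‖contract W (q l)‖)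
  rw [Finset.card_univ, Fintype.card_fin] at hcs
  refine hcs.trans (mul_le_mul_of_nonneg_left ?_ (by positivity))
  simp only [EuclideanSpace.real_norm_sq_eq]
  rw [Finset.sum_comm, Finset.sum_comm (f := fun j k => W j k ^ 2)]
  refine Finset.sum_le_sum fun k _ => ?_
  have hbes := hq.sum_inner_products_le (x := WithLp.toLp 2 fun j => W j k) (s := Finset.univ)
  rw [EuclideanSpace.real_norm_sq_eq] at hbes
  simpa [contract, PiLp.inner_apply] using hbes

theorem abs_sum_mul_le_sqrt_rank {m n p : ℕ} (A : Fin m → Fin n → Fin p → ℝ)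
    (x : EuclideanSpace ℝ (Fin m)) (W : Fin n → Fin p → ℝ) :
    |∑ i, ∑ j, ∑ k, A i j k * x i * W j k| ≤
      √(fl2 A).rank * tSpec A * ‖x‖ * √(∑ j, ∑ k, W j k ^ 2) := by
  obtain ⟨q, hq, hA⟩ := exists_orthonormal_rank (fl2 A)
  have key : ∑ i, ∑ j, ∑ k, A i j k * x i * W j k =
      ∑ l, ∑ i, ∑ j, ∑ k, A i j k * x i * q l j * contract W (q l) k := by
    refine Eq.trans ?_ Finset.sum_comm
    refine Finset.sum_congr rfl fun i _ => ?_
    have hA' : ∀ j k, A i j k = ∑ l, q l j * ∑ j', A i j' k * q l j' := fun j k => hA j (i, k)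
    calc ∑ j, ∑ k, A i j k * x i * W j k
        = ∑ j, ∑ k, ∑ l, ∑ j', q l j * (A i j' k * q l j') * x i * W j k := by
          refine Finset.sum_congr rfl fun j _ => Finset.sum_congr rfl fun k _ => ?_
          conv_lhs => rw [hA' j k]
          simp only [Finset.sum_mul, Finset.mul_sum]
      _ = ∑ l, ∑ j', ∑ k, ∑ j, q l j * (A i j' k * q l j') * x i * W j k := by
          refine (Finset.sum_congr rfl fun j _ => Finset.sum_comm).trans ?_
          refine Finset.sum_comm.trans (Finset.sum_congr rfl fun l _ => ?_)
          refine (Finset.sum_congr rfl fun j _ => Finset.sum_comm).trans ?_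
          exact Finset.sum_comm.trans (Finset.sum_congr rfl fun j' _ => Finset.sum_comm)
      _ = _ := by
          refine Finset.sum_congr rfl fun l _ => Finset.sum_congr rfl fun j' _ =>
            Finset.sum_congr rfl fun k _ => ?_
          simp only [contract, Finset.mul_sum]
          exact Finset.sum_congr rfl fun j _ => by ring
  rw [key]
  calc _ ≤ ∑ l, |∑ i, ∑ j, ∑ k, A i j k * x i * q l j * contract W (q l) k| :=
        Finset.abs_sum_le_sum_abs _ _
    _ ≤ ∑ l, tSpec A * ‖x‖ * ‖contract W (q l)‖ := by
        refine Finset.sum_le_sum fun l _ => ?_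
        simpa [hq.1 l] using abs_tensor_le A x (q l) (contract W (q l))
    _ = tSpec A * ‖x‖ * ∑ l, ‖contract W (q l)‖ := by rw [Finset.mul_sum]
    _ ≤ tSpec A * ‖x‖ * (√(fl2 A).rank * √(∑ j, ∑ k, W j k ^ 2)) :=
        mul_le_mul_of_nonneg_left (sum_norm_contract_le W q hq)
          (mul_nonneg (tSpec_nonneg A) (norm_nonneg _))
    _ = _ := by ring

theorem tNuc_le_sqrt_rank_mul_sum {m n p r : ℕ} (A : Fin m → Fin n → Fin p → ℝ)
    (x : Fin r → EuclideanSpace ℝ (Fin m)) (W : Fin r → Fin n → Fin p → ℝ)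
    (h : ∀ i j k, A i j k = ∑ t, x t i * W t j k) :
    tNuc A ≤ √(fl2 A).rank * ∑ t, ‖x t‖ * √(∑ j, ∑ k, W t j k ^ 2) := by
  obtain ⟨q, hq, hA⟩ := exists_orthonormal_rank (fl2 A)
  calc tNuc A ≤ ∑ s : Fin r × Fin (fl2 A).rank,
        ‖x s.1‖ * ‖q s.2‖ * ‖contract (W s.1) (q s.2)‖ := by
        refine tNuc_le_sum A _ _ _ fun i j k => ?_
        have hA' : A i j k = ∑ l, q l j * ∑ j', A i j' k * q l j' := hA j (i, k)
        rw [hA', Fintype.sum_prod_type, Finset.sum_comm]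
        refine Finset.sum_congr rfl fun l _ => ?_
        simp only [h, contract, Finset.mul_sum, Finset.sum_mul]
        rw [Finset.sum_comm]
        exact Finset.sum_congr rfl fun t _ => Finset.sum_congr rfl fun j' _ => by ring
    _ = ∑ t, ‖x t‖ * ∑ l, ‖contract (W t) (q l)‖ := by
        rw [Fintype.sum_prod_type]
        simp [hq.1, Finset.mul_sum]
    _ ≤ ∑ t, ‖x t‖ * (√(fl2 A).rank * √(∑ j, ∑ k, W t j k ^ 2)) :=
        Finset.sum_le_sum fun t _ => mul_le_mul_of_nonneg_left
          (sum_norm_contract_le (W t) q hq) (norm_nonneg _)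
    _ = _ := by
        rw [Finset.mul_sum]
        exact Finset.sum_congr rfl fun t _ => by ring

theorem tSpec_swap_last {m n p : ℕ} (A : Fin m → Fin n → Fin p → ℝ) :
    tSpec (fun i k j => A i j k) = tSpec A := by
  unfold tSpec
  congr 1
  ext r
  constructor
  · rintro ⟨x, z, y, hx, hz, hy, rfl⟩
    refine ⟨x, y, z, hx, hy, hz, congrArg _ (Finset.sum_congr rfl fun i _ => ?_)⟩
    rw [Finset.sum_comm]
    simp only [mul_right_comm]
  · rintro ⟨x, y, z, hx, hy, hz, rfl⟩
    refine ⟨x, z, y, hx, hz, hy, congrArg _ (Finset.sum_congr rfl fun i _ => ?_)⟩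
    rw [Finset.sum_comm]
    simp only [mul_right_comm]

theorem tSpec_swap_first {m n p : ℕ} (A : Fin m → Fin n → Fin p → ℝ) :
    tSpec (fun j i k => A i j k) = tSpec A := by
  unfold tSpec
  congr 1
  ext r
  constructor
  · rintro ⟨y, x, z, hy, hx, hz, rfl⟩
    refine ⟨x, y, z, hx, hy, hz, congrArg _ ?_⟩
    rw [Finset.sum_comm]
    simp only [mul_right_comm]
  · rintro ⟨x, y, z, hx, hy, hz, rfl⟩
    refine ⟨y, x, z, hy, hx, hz, congrArg _ ?_⟩
    rw [Finset.sum_comm]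
    simp only [mul_right_comm]

theorem tNuc_swap_last {m n p : ℕ} (A : Fin m → Fin n → Fin p → ℝ) :
    tNuc (fun i k j => A i j k) = tNuc A := by
  unfold tNuc
  congr 1
  ext s
  constructor
  · rintro ⟨r, x, z, y, h, rfl⟩
    exact ⟨r, x, y, z, fun i j k => by simp only [h i k j, mul_right_comm],
      by simp only [mul_right_comm]⟩
  · rintro ⟨r, x, y, z, h, rfl⟩
    exact ⟨r, x, z, y, fun i k j => by simp only [h i j k, mul_right_comm],
      by simp only [mul_right_comm]⟩

theorem tNuc_swap_first {m n p : ℕ} (A : Fin m → Fin n → Fin p → ℝ) :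
    tNuc (fun j i k => A i j k) = tNuc A := by
  unfold tNuc
  congr 1
  ext s
  constructor
  · rintro ⟨r, y, x, z, h, rfl⟩
    exact ⟨r, x, y, z, fun i j k => by simp only [h j i k, mul_comm (x _ _)],
      by simp only [mul_comm ‖x _‖]⟩
  · rintro ⟨r, x, y, z, h, rfl⟩
    exact ⟨r, y, x, z, fun j i k => by simp only [h i j k, mul_comm (y _ _)],
      by simp only [mul_comm ‖y _‖]⟩

theorem mSpec_fl1_le {m n p : ℕ} (A : Fin m → Fin n → Fin p → ℝ) :
    mSpec (fl1 A) ≤ √(min (fl2 A).rank (fl3 A).rank : ℝ) * tSpec A := by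
  refine Real.sSup_le ?_ (mul_nonneg (Real.sqrt_nonneg _) (tSpec_nonneg A))
  rintro _ ⟨x, w, hx, hw, rfl⟩
  have hw2 : √(∑ j, ∑ k, w (j, k) ^ 2) = 1 := by
    rw [← hw, EuclideanSpace.norm_eq, Fintype.sum_prod_type]
    simp
  have hw3 : √(∑ k, ∑ j, w (j, k) ^ 2) = 1 := by rw [Finset.sum_comm, hw2]
  have h2 := abs_sum_mul_le_sqrt_rank A x (fun j k => w (j, k))
  have h3 := abs_sum_mul_le_sqrt_rank (fun i k j => A i j k) x (fun k j => w (j, k))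
  rw [hx, hw2, mul_one, mul_one] at h2
  rw [hx, hw3, mul_one, mul_one, tSpec_swap_last] at h3
  have e2 : ∑ i, ∑ b, fl1 A i b * x i * w b = ∑ i, ∑ j, ∑ k, A i j k * x i * w (j, k) := by
    simp [fl1, Fintype.sum_prod_type]
  have e3 : ∑ i, ∑ b, fl1 A i b * x i * w b = ∑ i, ∑ k, ∑ j, A i j k * x i * w (j, k) := by
    rw [e2]
    exact Finset.sum_congr rfl fun i _ => Finset.sum_comm
  rcases min_choice ((fl2 A).rank : ℝ) ((fl3 A).rank : ℝ) with h | h <;> rw [h]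
  · rw [e2]; exact h2
  · rw [e3]; exact h3

theorem tNuc_le_mNuc_fl1 {m n p : ℕ} (A : Fin m → Fin n → Fin p → ℝ) :
    tNuc A ≤ √(min (fl2 A).rank (fl3 A).rank : ℝ) * mNuc (fl1 A) := by
  have main : ∀ (r : ℕ) (x : Fin r → EuclideanSpace ℝ (Fin m))
      (y : Fin r → EuclideanSpace ℝ (Fin n × Fin p)),
      (∀ a b, fl1 A a b = ∑ t, x t a * y t b) →
      tNuc A ≤ √(min (fl2 A).rank (fl3 A).rank : ℝ) * ∑ t, ‖x t‖ * ‖y t‖ := by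
    intro r x y h
    have hy2 : ∀ t, √(∑ j, ∑ k, y t (j, k) ^ 2) = ‖y t‖ := fun t => by
      rw [EuclideanSpace.norm_eq, Fintype.sum_prod_type]
      simp
    have hy3 : ∀ t, √(∑ k, ∑ j, y t (j, k) ^ 2) = ‖y t‖ := fun t => by
      rw [Finset.sum_comm, hy2]
    have h2 := tNuc_le_sqrt_rank_mul_sum A x (fun t j k => y t (j, k))
      (fun i j k => h i (j, k))
    have h3 := tNuc_le_sqrt_rank_mul_sum (fun i k j => A i j k) x (fun t k j => y t (j, k))
      (fun i k j => h i (j, k))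
    simp only [hy2] at h2
    simp only [hy3, tNuc_swap_last] at h3
    rcases min_choice ((fl2 A).rank : ℝ) ((fl3 A).rank : ℝ) with h | h <;> rw [h]
    · exact h2
    · exact h3
  obtain ⟨r, x, y, h⟩ := mNuc_nonempty A
  rcases (Real.sqrt_nonneg (min (fl2 A).rank (fl3 A).rank : ℝ)).eq_or_lt with h0 | h0
  · have := main r x y h
    rw [← h0, zero_mul] at this ⊢
    exact this
  · rw [← div_le_iff₀' h0]
    refine le_csInf ⟨_, r, x, y, h, rfl⟩ ?_
    rintro _ ⟨r, x, y, h, rfl⟩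
    rw [div_le_iff₀' h0]
    exact main r x y h

theorem mSpec_fl1_div_le {m n p : ℕ} (A : Fin m → Fin n → Fin p → ℝ) :
    mSpec (fl1 A) / √(min (fl2 A).rank (fl3 A).rank : ℝ) ≤ tSpec A :=
  div_le_of_le_mul₀ (Real.sqrt_nonneg _) (tSpec_nonneg A)
    ((mSpec_fl1_le A).trans_eq (mul_comm _ _))

theorem rank_fl3_swap_first {m n p : ℕ} (A : Fin m → Fin n → Fin p → ℝ) :
    (fl3 fun j i k => A i j k).rank = (fl3 A).rank :=
  Matrix.rank_submatrix (fl3 A) (Equiv.refl _) (Equiv.prodComm _ _)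

theorem rank_fl2_rotate {m n p : ℕ} (A : Fin m → Fin n → Fin p → ℝ) :
    (fl2 fun k i j => A i j k).rank = (fl1 A).rank :=
  Matrix.rank_submatrix (fl1 A) (Equiv.refl _) (Equiv.prodComm _ _)

theorem rank_fl3_rotate {m n p : ℕ} (A : Fin m → Fin n → Fin p → ℝ) :
    (fl3 fun k i j => A i j k).rank = (fl2 A).rank :=
  Matrix.rank_submatrix (fl2 A) (Equiv.refl _) (Equiv.prodComm _ _)

theorem tSpec_rotate {m n p : ℕ} (A : Fin m → Fin n → Fin p → ℝ) :
    tSpec (fun k i j => A i j k) = tSpec A :=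
  (tSpec_swap_first fun i k j => A i j k).trans (tSpec_swap_last A)

theorem tNuc_rotate {m n p : ℕ} (A : Fin m → Fin n → Fin p → ℝ) :
    tNuc (fun k i j => A i j k) = tNuc A :=
  (tNuc_swap_first fun i k j => A i j k).trans (tNuc_swap_last A)

/-- Theorem 9.3: polynomial-time computable bounds for the spectral and nuclear norms of
a 3-tensor in terms of the spectral and nuclear norms of its three flattenings and its
multilinear rank `(r₁, r₂, r₃)`. -/
theorem stmt19 {m n p : ℕ} (A : Fin m → Fin n → Fin p → ℝ) (r₁ r₂ r₃ : ℕ)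
    (h1 : (fl1 A).rank = r₁) (h2 : (fl2 A).rank = r₂) (h3 : (fl3 A).rank = r₃) :
    (max (max (mSpec (fl1 A) / Real.sqrt (min r₂ r₃))
              (mSpec (fl2 A) / Real.sqrt (min r₁ r₃)))
         (mSpec (fl3 A) / Real.sqrt (min r₁ r₂)) ≤ tSpec A ∧
      tSpec A ≤ min (min (mSpec (fl1 A)) (mSpec (fl2 A))) (mSpec (fl3 A))) ∧
    (max (max (mNuc (fl1 A)) (mNuc (fl2 A))) (mNuc (fl3 A)) ≤ tNuc A ∧
      tNuc A ≤ min (min (Real.sqrt (min r₂ r₃) * mNuc (fl1 A))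
                        (Real.sqrt (min r₁ r₃) * mNuc (fl2 A)))
                   (Real.sqrt (min r₁ r₂) * mNuc (fl3 A))) := by
  subst h1 h2 h3
  have s2 := mSpec_fl1_div_le (fun j i k => A i j k)
  have s3 := mSpec_fl1_div_le (fun k i j => A i j k)
  have t2 := tSpec_le_mSpec_fl1 (fun j i k => A i j k)
  have t3 := tSpec_le_mSpec_fl1 (fun k i j => A i j k)
  have u2 := mNuc_fl1_le_tNuc (fun j i k => A i j k)
  have u3 := mNuc_fl1_le_tNuc (fun k i j => A i j k)
  have v2 := tNuc_le_mNuc_fl1 (fun j i k => A i j k)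
  have v3 := tNuc_le_mNuc_fl1 (fun k i j => A i j k)
  rw [tSpec_swap_first] at s2 t2
  rw [tSpec_rotate] at s3 t3
  rw [tNuc_swap_first] at u2 v2
  rw [tNuc_rotate] at u3 v3
  rw [rank_fl3_swap_first] at s2 v2
  rw [rank_fl2_rotate, rank_fl3_rotate] at s3 v3
  exact ⟨⟨max_le (max_le (mSpec_fl1_div_le A) s2) s3,
      le_min (le_min (tSpec_le_mSpec_fl1 A) t2) t3⟩,
    max_le (max_le (mNuc_fl1_le_tNuc A) u2) u3,
    le_min (le_min (tNuc_le_mNuc_fl1 A) v2) v3⟩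
end
end
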